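/- Every subcubic graph (maximum degree at most 3) has strong list-chromatic index at most 10; that is, for every list assignment giving each edge a list of at least 10 colors, there is a strong edge coloring from the lists. -/

import Mathlib

/-- Two distinct edges of `G` conflict (are at distance at most 2) if they share an
endpoint or are joined by a common edge. -/
def edgeConflict {V : Type*} (G : SimpleGraph V) (e f : Sym2 V) : Prop :=
  e ≠ f ∧ ((∃ v, v ∈ e ∧ v ∈ f) ∨
    ∃ g ∈ G.edgeSet, (∃ v, v ∈ e ∧ v ∈ g) ∧ (∃ v, v ∈ g ∧ v ∈ f))

/-- `φ` is a strong edge coloring of `G`: edges at distance at most 2 get distinct colors. -/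
def IsStrongEdgeColoring {V : Type*} (G : SimpleGraph V) (φ : Sym2 V → ℕ) : Prop :=
  ∀ e ∈ G.edgeSet, ∀ f ∈ G.edgeSet, edgeConflict G e f → φ e ≠ φ f

/-- `φ` is a strong edge coloring of `G` from the lists `L`. -/
def IsStrongListColoring {V : Type*} (G : SimpleGraph V) (L : Sym2 V → Finset ℕ)
    (φ : Sym2 V → ℕ) : Prop :=
  IsStrongEdgeColoring G φ ∧ ∀ e ∈ G.edgeSet, φ e ∈ L e

/-- `G` is strongly `k`-edge choosable. -/
def StronglyEdgeChoosable {V : Type*} (G : SimpleGraph V) (k : ℕ) : Prop :=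
  ∀ L : Sym2 V → Finset ℕ, (∀ e ∈ G.edgeSet, k ≤ (L e).card) →
    ∃ φ, IsStrongListColoring G L φ

/-- The coefficient of `∏ i, X i ^ m i` in the product of `X a - X b` over the pairs `(a, b)`
of the list. -/
noncomputable def orientCoeff : List (ℕ × ℕ) → (ℕ → ℕ) → ℤ
  | [], m => open Classical in if m = 0 then 1 else 0
  | (a, b) :: E, m =>
    (if m a = 0 then 0 else orientCoeff E (Function.update m a (m a - 1))) -
      (if m b = 0 then 0 else orientCoeff E (Function.update m b (m b - 1)))

section Nullstellensatz

open MvPolynomial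

/-- The product of `X a - X b` over the pairs `(a, b)` of the list. -/
noncomputable def diffProd {N : ℕ} (E : List (Fin N × Fin N)) : MvPolynomial (Fin N) ℤ :=
  (E.map fun p => X p.1 - X p.2).prod

/-- Extension of an exponent vector by zero. -/
def extendZero {N : ℕ} (t : Fin N →₀ ℕ) (i : ℕ) : ℕ := if h : i < N then t ⟨i, h⟩ else 0

theorem extendZero_coe {N : ℕ} (t : Fin N →₀ ℕ) (a : Fin N) : extendZero t a = t a := by
  simp [extendZero]

theorem extendZero_sub {N : ℕ} (t : Fin N →₀ ℕ) (a : Fin N) :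
    extendZero (t - Finsupp.single a 1) =
      Function.update (extendZero t) a (extendZero t a - 1) := by
  funext i
  by_cases h : i = a
  · subst h
    simp [extendZero]
  · rw [Function.update_of_ne h]
    unfold extendZero
    split_ifs with hi
    · have : a ≠ ⟨i, hi⟩ := fun e => h (by rw [e])
      simp [Finsupp.single_eq_of_ne this.symm]
    · rfl

theorem coeff_diffProd {N : ℕ} (E : List (Fin N × Fin N)) (t : Fin N →₀ ℕ) :
    (diffProd E).coeff t =
      orientCoeff (E.map fun p => ((p.1 : ℕ), (p.2 : ℕ))) (extendZero t) := by
  induction E generalizing t with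
  | nil =>
    have : extendZero t = 0 ↔ 0 = t := by
      constructor
      · intro h
        ext i
        have := congrFun h i
        rw [extendZero_coe] at this
        simpa using this.symm
      · rintro rfl
        funext i
        simp [extendZero]
    simp [diffProd, orientCoeff, coeff_one, this]
  | cons p E ih =>
    have key : ∀ a : Fin N, (X a * diffProd E).coeff t =
        if extendZero t a = 0 then 0 else
          orientCoeff (E.map fun p => ((p.1 : ℕ), (p.2 : ℕ)))
            (Function.update (extendZero t) a (extendZero t a - 1)) := by
      intro a
      rw [coeff_X_mul', ih, extendZero_sub, extendZero_coe]
      by_cases h : t a = 0 <;> simp [h]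
    have : diffProd (p :: E) = X p.1 * diffProd E - X p.2 * diffProd E := by
      simp [diffProd, sub_mul]
    rw [this, coeff_sub, key, key]
    simp [orientCoeff]

theorem diffProd_isHomogeneous {N : ℕ} (E : List (Fin N × Fin N)) :
    (diffProd E).IsHomogeneous E.length := by
  induction E with
  | nil => simpa [diffProd] using isHomogeneous_one (Fin N) ℤ
  | cons p E ih =>
    have : diffProd (p :: E) = (X p.1 - X p.2) * diffProd E := by simp [diffProd]
    rw [this, List.length_cons, add_comm]
    exact ((isHomogeneous_X ℤ p.1).sub (isHomogeneous_X ℤ p.2)).mul ih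

/-- A list colouring form of the combinatorial Nullstellensatz: if the coefficient of
`∏ i, X i ^ m i` is nonzero then the conflict graph `E` can be coloured from lists with more
than `m i` colours. -/
theorem exists_coloring_of_orientCoeff_ne_zero {N : ℕ} (E : List (ℕ × ℕ)) (m : ℕ → ℕ)
    (hE : ∀ p ∈ E, p.1 < N ∧ p.2 < N) (hm : ∀ i, N ≤ i → m i = 0) (h : orientCoeff E m ≠ 0)
    (L : ℕ → Finset ℕ) (hL : ∀ i < N, m i < (L i).card) :
    ∃ c : ℕ → ℕ, (∀ i < N, c i ∈ L i) ∧ ∀ p ∈ E, c p.1 ≠ c p.2 := by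
  classical
  obtain ⟨E, rfl⟩ : ∃ E' : List (Fin N × Fin N),
      E'.map (fun p => ((p.1 : ℕ), (p.2 : ℕ))) = E := by
    clear h
    induction E with
    | nil => exact ⟨[], rfl⟩
    | cons p E ih =>
      obtain ⟨E', hE'⟩ := ih fun q hq => hE q (List.mem_cons_of_mem _ hq)
      have := hE p List.mem_cons_self
      exact ⟨(⟨p.1, this.1⟩, ⟨p.2, this.2⟩) :: E', by simp [hE']⟩
  let t : Fin N →₀ ℕ := Finsupp.equivFunOnFinite.symm fun i => m i
  have ht : extendZero t = m := by
    funext i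
    unfold extendZero
    split_ifs with hi
    · rfl
    · exact (hm i (not_lt.mp hi)).symm
  have hc : (diffProd E).coeff t ≠ 0 := by rwa [coeff_diffProd, ht]
  have hdeg : (diffProd E).totalDegree = t.degree := by
    have hne : diffProd E ≠ 0 := fun h0 => hc (by rw [h0, coeff_zero])
    rw [(diffProd_isHomogeneous E).totalDegree hne]
    by_contra hd
    exact hc ((diffProd_isHomogeneous E).coeff_eq_zero fun e => hd e.symm)
  obtain ⟨s, hs, hev⟩ := combinatorial_nullstellensatz_exists_eval_nonzero (diffProd E) t hc hdeg
    (fun i => (L i).image (fun n : ℕ => (n : ℤ))) (by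
      intro i
      rw [Finset.card_image_of_injective _ Nat.cast_injective]
      exact hL i i.2)
  have hs' : ∀ i : Fin N, ∃ n ∈ L i, (n : ℤ) = s i := by
    intro i
    simpa using hs i
  choose c hcL hcs using hs'
  refine ⟨fun i => if hi : i < N then c ⟨i, hi⟩ else 0, fun i hi => ?_, ?_⟩
  · simpa [hi] using hcL ⟨i, hi⟩
  · intro p hp
    obtain ⟨q, hq, rfl⟩ := List.mem_map.mp hp
    simp only [Fin.is_lt, dite_true]
    intro hcq
    apply hev
    rw [diffProd, map_list_prod, List.prod_eq_zero_iff, List.map_map, List.mem_map]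
    refine ⟨q, hq, ?_⟩
    simp [← hcs, hcq]

end Nullstellensatz

/-- A sparse vector: a list of pairs of a code and a coefficient modulo `1009`. -/
abbrev SparseVec := List (ℕ × ℕ)

/-- The pairing of a sparse vector with a function on codes. -/
def SparseVec.pair (I : ℕ → ZMod 1009) (D : SparseVec) : ZMod 1009 :=
  (D.map fun p => (p.2 : ZMod 1009) * I p.1).sum

/-! The following functions are written in terms of recursors, which makes their reduction by the
kernel much faster. -/

/-- `k x`, arranged so that kernel reduction evaluates `x` first. -/
noncomputable def forceNat {α : Type} (x : ℕ) (k : ℕ → α) : α :=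
  Nat.rec (k 0) (fun y _ => k (Nat.succ y)) x

/-- Lower the digit of weight `w` of every code, dropping the codes where this digit is zero,
and multiply the coefficients by `q`. -/
noncomputable def lowerDigit (w q : ℕ) (D : SparseVec) : SparseVec :=
  List.rec [] (fun p _ D' =>
    Bool.rec
      (forceNat (Nat.sub p.1 w) fun s => forceNat (Nat.mod (Nat.mul p.2 q) 1009) fun c =>
        (s, c) :: D')
      D' (Nat.beq (Nat.mod (Nat.div p.1 w) 16) 0)) D

/-- Sum of two sparse vectors with increasing codes. -/
noncomputable def mergeVec (k : ℕ) : SparseVec → SparseVec → SparseVec :=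
  Nat.rec (fun D D' => D ++ D') (fun _ ih D D' =>
    List.rec D' (fun p D₁ _ =>
      List.rec (p :: D₁) (fun p' D₁' _ =>
        Bool.rec
          (Bool.rec (p' :: ih (p :: D₁) D₁') (p :: ih D₁ (p' :: D₁')) (Nat.ble p.1 p'.1))
          (Nat.rec (ih D₁ D₁') (fun c _ => (p.1, Nat.succ c) :: ih D₁ D₁')
            (Nat.mod (Nat.add p.2 p'.2) 1009))
          (Nat.beq p.1 p'.1)) D') D) k

/-- Multiplication by `X a - X b`, on coefficient extraction functionals. -/
noncomputable def edgeStep (a b : ℕ) (D : SparseVec) : SparseVec :=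
  forceNat (Nat.pow 16 a) fun w => forceNat (Nat.pow 16 b) fun w' =>
    mergeVec 10000 (lowerDigit w 1 D) (lowerDigit w' 1008 D)

/-- Keep the codes whose digit of weight `w` is at most `m`. -/
noncomputable def keepLe (w m : ℕ) (D : SparseVec) : SparseVec :=
  List.rec [] (fun p _ D' =>
    Bool.rec D' (p :: D') (Nat.ble (Nat.mod (Nat.div p.1 w) 16) m)) D

/-- The number of members of a list of pairs which contain `a`. -/
noncomputable def countAt (a : ℕ) (E : List (ℕ × ℕ)) : ℕ :=
  List.rec 0 (fun p _ n =>
    Bool.rec (Bool.rec n (Nat.succ n) (Nat.beq p.2 a)) (Nat.succ n) (Nat.beq p.1 a)) E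

/-- Discard the codes with a digit at `a` exceeding the number of occurrences of `a` in `E`, unless
`a` occurs in `F`. -/
noncomputable def prune (a : ℕ) (E F : List (ℕ × ℕ)) (D : SparseVec) : SparseVec :=
  Nat.rec (forceNat (countAt a E) fun m => forceNat (Nat.pow 16 a) fun w => keepLe w m D)
    (fun _ _ => D) (countAt a F)

/-- Multiply by all factors in the first list, where the factors in the second list are still to
come. -/
noncomputable def runE (E F : List (ℕ × ℕ)) : SparseVec → SparseVec :=
  List.rec (fun D => D) (fun p E' ih D =>
    ih (prune p.1 E' F (prune p.2 E' F (edgeStep p.1 p.2 D)))) E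

/-- The exponent vector with hexadecimal code `s`. -/
def digits (s i : ℕ) : ℕ := s / 16 ^ i % 16

theorem digits_sub {s a : ℕ} (h : digits s a ≠ 0) :
    digits (s - 16 ^ a) = Function.update (digits s) a (digits s a - 1) := by
  unfold digits at *
  have hw : 0 < 16 ^ a := by positivity
  have hs : s = 16 ^ a * (s / 16 ^ a) + s % 16 ^ a := (Nat.div_add_mod s (16 ^ a)).symm
  have hlo : s % 16 ^ a < 16 ^ a := Nat.mod_lt _ hw
  generalize s / 16 ^ a = q at *
  generalize s % 16 ^ a = r at *
  obtain ⟨q', rfl⟩ : ∃ q', q = q' + 1 := ⟨q - 1, by omega⟩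
  have hs' : s - 16 ^ a = 16 ^ a * q' + r := by rw [hs, mul_add]; omega
  funext i
  rcases lt_trichotomy i a with hi | rfl | hi
  · rw [Function.update_of_ne hi.ne, hs', hs]
    obtain ⟨k, rfl⟩ := Nat.exists_eq_add_of_lt hi
    have e : 16 ^ (i + k + 1) * (q' + 1) + r =
        (16 ^ (i + k + 1) * q' + r) + 16 ^ i * (16 * 16 ^ k) := by ring
    rw [e, Nat.add_mul_div_left _ _ (by positivity), Nat.add_mul_mod_self_left]
  · rw [Function.update_self, hs']
    rw [Nat.mul_add_div hw, Nat.div_eq_of_lt hlo]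
    omega
  · rw [Function.update_of_ne hi.ne', hs', hs]
    obtain ⟨k, rfl⟩ := Nat.exists_eq_add_of_lt hi
    have e : 16 ^ (a + k + 1) = 16 ^ a * (16 * 16 ^ k) := by ring
    have e' : ∀ x, (16 ^ a * x + r) / 16 ^ (a + k + 1) = x / 16 / 16 ^ k := fun x => by
      rw [e, ← Nat.div_div_eq_div_mul, Nat.mul_add_div hw, Nat.div_eq_of_lt hlo, add_zero,
        Nat.div_div_eq_div_mul]
    rw [e', e']
    congr 2
    omega

theorem digits_zero : digits 0 = 0 := by
  funext i
  simp [digits]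

theorem digits_eq_zero {s N i : ℕ} (h : s < 16 ^ N) (hi : N ≤ i) : digits s i = 0 := by
  rw [digits, Nat.div_eq_of_lt (h.trans_le (Nat.pow_le_pow_right (by norm_num) hi))]

theorem forceNat_eq {α : Type} (x : ℕ) (k : ℕ → α) : forceNat x k = k x := by
  cases x <;> rfl

theorem lowerDigit_cons (w q s c : ℕ) (D : SparseVec) :
    lowerDigit w q ((s, c) :: D) =
      if s / w % 16 = 0 then lowerDigit w q D else (s - w, c * q % 1009) :: lowerDigit w q D := by
  change (Bool.rec (forceNat (s - w) fun s' => forceNat (c * q % 1009) fun c' =>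
    (s', c') :: lowerDigit w q D) (lowerDigit w q D) (Nat.beq (s / w % 16) 0) : SparseVec) = _
  rw [forceNat_eq, forceNat_eq]
  split
  · next h => rw [h]; rfl
  · next h => rw [Bool.eq_false_iff.mpr fun h' => h (Nat.eq_of_beq_eq_true h')]

theorem keepLe_cons (w m s c : ℕ) (D : SparseVec) :
    keepLe w m ((s, c) :: D) =
      if s / w % 16 ≤ m then (s, c) :: keepLe w m D else keepLe w m D := by
  change (Bool.rec (keepLe w m D) ((s, c) :: keepLe w m D) (Nat.ble (s / w % 16) m) :
    SparseVec) = _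
  split
  · next h => rw [Nat.ble_eq_true_of_le h]
  · next h => rw [Bool.eq_false_iff.mpr fun h' => h (Nat.le_of_ble_eq_true h')]

theorem countAt_cons (a : ℕ) (p : ℕ × ℕ) (E : List (ℕ × ℕ)) :
    countAt a (p :: E) = countAt a E + if p.1 = a ∨ p.2 = a then 1 else 0 := by
  change (Bool.rec (Bool.rec (countAt a E) (Nat.succ (countAt a E)) (Nat.beq p.2 a))
    (Nat.succ (countAt a E)) (Nat.beq p.1 a) : ℕ) = _
  by_cases h1 : p.1 = a
  · simp [h1]
  · rw [Bool.eq_false_iff.mpr fun h' => h1 (Nat.eq_of_beq_eq_true h')]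
    by_cases h2 : p.2 = a
    · simp [h2]
    · rw [Bool.eq_false_iff.mpr fun h' => h2 (Nat.eq_of_beq_eq_true h')]
      simp [h1, h2]

theorem countAt_eq_zero {a : ℕ} {E : List (ℕ × ℕ)} :
    countAt a E = 0 ↔ ∀ p ∈ E, p.1 ≠ a ∧ p.2 ≠ a := by
  induction E with
  | nil => simp [countAt]
  | cons p E ih =>
    rw [countAt_cons, List.forall_mem_cons, ← ih]
    split <;> simp <;> tauto

theorem countAt_append (a : ℕ) (E E' : List (ℕ × ℕ)) :
    countAt a (E ++ E') = countAt a E + countAt a E' := by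
  induction E with
  | nil => exact (zero_add _).symm
  | cons p E ih => rw [List.cons_append, countAt_cons, countAt_cons, ih]; omega

namespace SparseVec

theorem pair_nil (I : ℕ → ZMod 1009) : pair I [] = 0 := rfl

theorem pair_cons (I : ℕ → ZMod 1009) (s c : ℕ) (D : SparseVec) :
    pair I ((s, c) :: D) = c * I s + pair I D := rfl

theorem pair_append (I : ℕ → ZMod 1009) (D D' : SparseVec) :
    pair I (D ++ D') = pair I D + pair I D' := by
  simp [pair]

theorem pair_congr {I J : ℕ → ZMod 1009} (D : SparseVec) (h : ∀ p ∈ D, I p.1 = J p.1) :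
    pair I D = pair J D := by
  unfold pair
  congr 1
  exact List.map_congr_left fun p hp => by rw [h p hp]

theorem pair_lowerDigit (I : ℕ → ZMod 1009) (a q : ℕ) (D : SparseVec) :
    pair I (lowerDigit (16 ^ a) q D) =
      q * pair (fun s => if digits s a = 0 then 0 else I (s - 16 ^ a)) D := by
  induction D with
  | nil => simp [lowerDigit, pair_nil]
  | cons p D ih =>
    obtain ⟨s, c⟩ := p
    rw [pair_cons, lowerDigit_cons]
    change pair I (if digits s a = 0 then _ else _) = _
    split
    · rw [ih]
      ring
    · rw [pair_cons, ih, ZMod.natCast_mod]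
      push_cast
      ring

theorem pair_mergeVec (I : ℕ → ZMod 1009) (k : ℕ) (D D' : SparseVec) :
    pair I (mergeVec k D D') = pair I D + pair I D' := by
  induction k generalizing D D' with
  | zero => exact pair_append I D D'
  | succ k ih =>
    rcases D with _ | ⟨⟨s, c⟩, D⟩
    · exact (zero_add _).symm
    rcases D' with _ | ⟨⟨s', c'⟩, D'⟩
    · exact (add_zero _).symm
    change pair I (Bool.rec
      (Bool.rec ((s', c') :: mergeVec k ((s, c) :: D) D') ((s, c) :: mergeVec k D ((s', c') :: D'))
        (Nat.ble s s'))
      (Nat.rec (mergeVec k D D') (fun d _ => (s, Nat.succ d) :: mergeVec k D D')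
        ((c + c') % 1009))
      (Nat.beq s s')) = _
    cases h : Nat.beq s s' with
    | true =>
      obtain rfl := Nat.eq_of_beq_eq_true h
      have hc : (((c + c') % 1009 : ℕ) : ZMod 1009) = c + c' := by
        rw [ZMod.natCast_mod]; push_cast; rfl
      cases hd : (c + c') % 1009 with
      | zero =>
        rw [hd] at hc
        change pair I (mergeVec k D D') = _
        rw [ih, pair_cons, pair_cons]
        linear_combination (I s) * hc
      | succ d =>
        rw [hd] at hc
        change pair I ((s, d + 1) :: mergeVec k D D') = _
        rw [pair_cons, ih, pair_cons, pair_cons, hc]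
        ring
    | false =>
      cases Nat.ble s s' with
      | true =>
        change pair I ((s, c) :: mergeVec k D ((s', c') :: D')) = _
        rw [pair_cons, ih, pair_cons, pair_cons]; ring
      | false =>
        change pair I ((s', c') :: mergeVec k ((s, c) :: D) D') = _
        rw [pair_cons, ih, pair_cons, pair_cons]; ring

theorem pair_sub (I J : ℕ → ZMod 1009) (D : SparseVec) :
    pair I D - pair J D = pair (fun s => I s - J s) D := by
  induction D with
  | nil => simp [pair_nil]
  | cons p D ih =>
    obtain ⟨s, c⟩ := p
    rw [pair_cons, pair_cons, pair_cons, ← ih]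
    ring

theorem pair_edgeStep (I : ℕ → ZMod 1009) (a b : ℕ) (D : SparseVec) :
    pair I (edgeStep a b D) =
      pair (fun s => (if digits s a = 0 then 0 else I (s - 16 ^ a)) -
        (if digits s b = 0 then 0 else I (s - 16 ^ b))) D := by
  rw [edgeStep, forceNat_eq, forceNat_eq, pair_mergeVec]
  change pair I (lowerDigit (16 ^ a) 1 D) + pair I (lowerDigit (16 ^ b) 1008 D) = _
  rw [pair_lowerDigit, pair_lowerDigit]
  have h : ((1008 : ℕ) : ZMod 1009) = -1 := by decide
  rw [h]
  rw [← pair_sub]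
  push_cast
  ring

theorem pair_keepLe (I : ℕ → ZMod 1009) (a m : ℕ) (h : ∀ s, m < digits s a → I s = 0)
    (D : SparseVec) : pair I (keepLe (16 ^ a) m D) = pair I D := by
  induction D with
  | nil => rfl
  | cons p D ih =>
    obtain ⟨s, c⟩ := p
    rw [keepLe_cons]
    split
    · rw [pair_cons, pair_cons, ih]
    · next hk => rw [pair_cons, ih, h s (not_le.mp hk), mul_zero, zero_add]

end SparseVec

theorem orientCoeff_eq_zero {E : List (ℕ × ℕ)} {m : ℕ → ℕ} {i : ℕ}
    (hm : countAt i E < m i) : orientCoeff E m = 0 := by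
  induction E generalizing m with
  | nil =>
    rw [orientCoeff, if_neg]
    rintro rfl
    exact absurd hm (Nat.not_lt_zero _)
  | cons p E ih =>
    obtain ⟨a, b⟩ := p
    have key : ∀ c, a = c ∨ b = c →
        (if m c = 0 then 0 else orientCoeff E (Function.update m c (m c - 1))) = 0 := by
      intro c hc
      split
      · rfl
      refine ih ?_
      rw [countAt_cons] at hm
      by_cases hci : c = i
      · subst hci
        rw [if_pos hc] at hm
        rw [Function.update_self]
        omega
      · rw [Function.update_of_ne (Ne.symm hci)]
        omega
    rw [orientCoeff, key a (Or.inl rfl), key b (Or.inr rfl), sub_zero]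

section Window

open Classical in
/-- The exponent vector which at `ρ a`, for `a < W`, is the `a`-th digit of `c`, and which agrees
with `bg` elsewhere. -/
noncomputable def windowExp (W : ℕ) (ρ bg : ℕ → ℕ) (c j : ℕ) : ℕ :=
  if h : ∃ a, a < W ∧ ρ a = j then digits c h.choose else bg j

variable {W : ℕ} {ρ bg : ℕ → ℕ}

theorem windowExp_apply (hρ : Set.InjOn ρ (Set.Iio W)) (c : ℕ) {a : ℕ} (ha : a < W) :
    windowExp W ρ bg c (ρ a) = digits c a := by
  have h : ∃ b, b < W ∧ ρ b = ρ a := ⟨a, ha, rfl⟩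
  rw [windowExp, dif_pos h]
  congr 1
  exact hρ h.choose_spec.1 ha h.choose_spec.2

theorem windowExp_of_ne (c : ℕ) {j : ℕ} (h : ∀ a < W, ρ a ≠ j) :
    windowExp W ρ bg c j = bg j := by
  rw [windowExp, dif_neg]
  rintro ⟨a, ha, e⟩
  exact h a ha e

theorem windowExp_eq (hρ : Set.InjOn ρ (Set.Iio W)) {c : ℕ} {g : ℕ → ℕ}
    (h1 : ∀ a < W, g (ρ a) = digits c a) (h2 : ∀ j, (∀ a < W, ρ a ≠ j) → g j = bg j) :
    windowExp W ρ bg c = g := by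
  funext j
  by_cases h : ∃ a < W, ρ a = j
  · obtain ⟨a, ha, rfl⟩ := h
    rw [windowExp_apply hρ c ha, h1 a ha]
  · push Not at h
    rw [windowExp_of_ne c h, h2 j h]

theorem windowExp_sub (hρ : Set.InjOn ρ (Set.Iio W)) {c a : ℕ} (ha : a < W)
    (hd : digits c a ≠ 0) :
    windowExp W ρ bg (c - 16 ^ a) =
      Function.update (windowExp W ρ bg c) (ρ a) (windowExp W ρ bg c (ρ a) - 1) := by
  rw [windowExp_apply hρ c ha]
  refine windowExp_eq hρ (fun b hb => ?_) fun j hj => ?_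
  · rw [digits_sub hd]
    by_cases hba : b = a
    · rw [hba, Function.update_self, Function.update_self]
    · rw [Function.update_of_ne hba, Function.update_of_ne fun e => hba (hρ hb ha e),
        windowExp_apply hρ c hb]
  · rw [Function.update_of_ne (hj a ha).symm, windowExp_of_ne c hj]

/-- Renaming of the vertices in a list of pairs. -/
def renamePairs (ρ : ℕ → ℕ) (E : List (ℕ × ℕ)) : List (ℕ × ℕ) := E.map fun p => (ρ p.1, ρ p.2)

theorem countAt_renamePairs (hρ : Set.InjOn ρ (Set.Iio W)) {a : ℕ} (ha : a < W)
    {E : List (ℕ × ℕ)} (hE : ∀ p ∈ E, p.1 < W ∧ p.2 < W) :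
    countAt (ρ a) (renamePairs ρ E) = countAt a E := by
  induction E with
  | nil => rfl
  | cons p E ih =>
    have hp := hE p List.mem_cons_self
    rw [renamePairs, List.map_cons, countAt_cons, countAt_cons, ← renamePairs,
      ih fun p hp => hE p (List.mem_cons_of_mem _ hp)]
    simp only [hρ.eq_iff hp.1 ha, hρ.eq_iff hp.2 ha]

/-- `orientCoeff` modulo `1009`, on codes of exponent vectors in a window. -/
noncomputable def windowCoeff (W : ℕ) (ρ bg : ℕ → ℕ) (E : List (ℕ × ℕ)) (s : ℕ) : ZMod 1009 :=
  orientCoeff E (windowExp W ρ bg s)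

theorem windowCoeff_cons (hρ : Set.InjOn ρ (Set.Iio W)) {a b : ℕ} (ha : a < W) (hb : b < W)
    (E : List (ℕ × ℕ)) (s : ℕ) :
    windowCoeff W ρ bg ((ρ a, ρ b) :: E) s =
      (if digits s a = 0 then 0 else windowCoeff W ρ bg E (s - 16 ^ a)) -
      (if digits s b = 0 then 0 else windowCoeff W ρ bg E (s - 16 ^ b)) := by
  have key : ∀ a < W, (((if windowExp W ρ bg s (ρ a) = 0 then 0 else
      orientCoeff E (Function.update (windowExp W ρ bg s) (ρ a)
        (windowExp W ρ bg s (ρ a) - 1)) : ℤ)) : ZMod 1009) =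
      if digits s a = 0 then 0 else windowCoeff W ρ bg E (s - 16 ^ a) := by
    intro a ha
    rw [windowExp_apply hρ s ha]
    split_ifs with h
    · simp
    · rw [windowCoeff, windowExp_sub hρ ha h, windowExp_apply hρ s ha]
  rw [windowCoeff, orientCoeff, Int.cast_sub, key a ha, key b hb]

/-- Correctness of `runE`, where the list `F` contains all the places of the window which occur
in `E'`. -/
theorem pair_runE (hρ : Set.InjOn ρ (Set.Iio W)) (E F E' : List (ℕ × ℕ))
    (hE : ∀ p ∈ E, p.1 < W ∧ p.2 < W)
    (hF : ∀ a < W, (∀ p ∈ F, p.1 ≠ a ∧ p.2 ≠ a) → ∀ p ∈ E', p.1 ≠ ρ a ∧ p.2 ≠ ρ a)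
    (D : SparseVec) :
    SparseVec.pair (windowCoeff W ρ bg E') (runE E F D) =
      SparseVec.pair (windowCoeff W ρ bg (renamePairs ρ E ++ E')) D := by
  induction E generalizing D with
  | nil => rfl
  | cons p E ih =>
    obtain ⟨a, b⟩ := p
    have hab := hE (a, b) List.mem_cons_self
    have hE' := fun p hp => hE p (List.mem_cons_of_mem _ hp)
    have hprune : ∀ a < W, ∀ D, SparseVec.pair (windowCoeff W ρ bg (renamePairs ρ E ++ E'))
        (prune a E F D) = SparseVec.pair (windowCoeff W ρ bg (renamePairs ρ E ++ E')) D := by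
      intro a ha D
      unfold prune
      cases h : countAt a F with
      | zero =>
        change SparseVec.pair _ (forceNat (countAt a E) fun m => forceNat (Nat.pow 16 a) fun w =>
          keepLe w m D) = _
        rw [forceNat_eq, forceNat_eq]
        refine SparseVec.pair_keepLe _ _ _ (fun s hs => ?_) D
        rw [windowCoeff, orientCoeff_eq_zero (i := ρ a), Int.cast_zero]
        rw [windowExp_apply hρ s ha, countAt_append,
          countAt_eq_zero.mpr (hF a ha (countAt_eq_zero.mp h)), add_zero]
        rwa [countAt_renamePairs hρ ha hE']
      | succ n => rfl
    change SparseVec.pair _ (runE E F (prune a E F (prune b E F (edgeStep a b D)))) = _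
    rw [ih hE', hprune a hab.1, hprune b hab.2, SparseVec.pair_edgeStep]
    congr 1
    funext s
    exact (windowCoeff_cons hρ hab.1 hab.2 _ s).symm

end Window

/-- The computable test that `orientCoeff E (digits s)` is nonzero modulo `1009`, when all vertices
are below `N`. -/
noncomputable def coeffTest (N : ℕ) (E : List (ℕ × ℕ)) (s : ℕ) : Bool :=
  Nat.blt s (16 ^ N) && E.all (fun p => Nat.blt p.1 N && Nat.blt p.2 N) &&
  match runE E [] [(s, 1)] with
  | [(0, c)] => Nat.blt 0 c && Nat.blt c 1009
  | _ => false

theorem orientCoeff_ne_zero_of_coeffTest {N : ℕ} {E : List (ℕ × ℕ)} {s : ℕ}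
    (h : coeffTest N E s = true) : orientCoeff E (digits s) ≠ 0 := by
  rw [coeffTest, Bool.and_eq_true, Bool.and_eq_true] at h
  obtain ⟨⟨hs, hE⟩, h⟩ := h
  have hid : ∀ s' < 16 ^ N, windowExp N id 0 s' = digits s' := fun s' hs' =>
    windowExp_eq (Set.injOn_id _) (fun _ _ => rfl) fun j hj => digits_eq_zero hs' (by
      by_contra hlt
      exact hj j (not_le.mp hlt) rfl)
  have hE' : ∀ p ∈ E, p.1 < N ∧ p.2 < N := by
    intro p hp
    have := List.all_eq_true.mp hE p hp
    simpa [Nat.blt_eq] using this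
  have key := pair_runE (bg := 0) (Set.injOn_id (Set.Iio N)) E [] [] hE' (by simp) [(s, 1)]
  split at h
  · next c hc =>
    simp only [Bool.and_eq_true, Nat.blt_eq] at h hs
    rw [hc, SparseVec.pair_cons, SparseVec.pair_cons, SparseVec.pair_nil, windowCoeff, windowCoeff,
      hid s hs, hid 0 (by positivity), digits_zero] at key
    intro h0
    have hr : renamePairs id E = E := by simp [renamePairs]
    rw [List.append_nil, hr, h0] at key
    have h1 : (c : ZMod 1009) = 0 := by simpa [orientCoeff, SparseVec.pair_nil] using key
    rw [ZMod.natCast_eq_zero_iff] at h1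
    exact absurd (Nat.le_of_dvd h.1 h1) (by omega)
  · exact absurd h (by simp)

section Periodic

/-- The conflicts of the two new edges `3, 4` of a path of cycle edges and pendant edges, with the
preceding three edges and with each other. -/
def pathBlock : List (ℕ × ℕ) := [(0, 3), (1, 3), (2, 3), (0, 4), (1, 4), (2, 4), (3, 4)]

/-- Conflicts along a path of cycle edges (even) and pendant edges (odd). -/
def pathEdges : ℕ → List (ℕ × ℕ)
  | 0 => []
  | k + 1 => pathBlock ++ renamePairs (· + 2) (pathEdges k)

/-- The two ends of the path as a window. -/
def pathWindow (k a : ℕ) : ℕ := if a < 3 then 2 * k + a else if a < 6 then a - 3 else 2 * k + a - 3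

/-- The exponents inside the path. -/
def pathExp (k j : ℕ) : ℕ := if 2 < j ∧ j < 2 * k then (if j % 2 = 1 then 3 else 4) else 0

/-- Conflicts of the edges closing the path up to a cycle. -/
def closingEdges : List (ℕ × ℕ) :=
  [(0, 6), (1, 6), (2, 6), (0, 7), (1, 7), (2, 7), (6, 7), (2, 8), (6, 8), (7, 8), (2, 3), (6, 3),
    (7, 3), (8, 3), (7, 4), (8, 4), (3, 4), (7, 5), (8, 5), (3, 5), (4, 5)]

/-- Conflicts of the edges of a cycle of length `k + 3` and its pendant edges. -/
def cycleEdges (k : ℕ) : List (ℕ × ℕ) := renamePairs (pathWindow k) closingEdges ++ pathEdges k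

/-- Exponents on the edges of a cycle and its pendant edges. -/
noncomputable def cycleExp (k : ℕ) : ℕ → ℕ := windowExp 9 (pathWindow k) (pathExp k) 14248268852

/-- The functional evaluated on the exponents at the ends of the path. -/
noncomputable def pathCoeff (k : ℕ) : ℕ → ZMod 1009 :=
  windowCoeff 6 (pathWindow k) (pathExp k) (pathEdges k)

/-- Replace the digits in places `≥ 6` by those of `x`. -/
noncomputable def setHigh (x : ℕ) : SparseVec → SparseVec
  | [] => []
  | (s, c) :: D => forceNat (16 ^ 6 * x + s % 16 ^ 6) fun s' => (s', c) :: setHigh x D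

/-- Drop the digits in the places `3, 4`. -/
noncomputable def dropMiddle : SparseVec → SparseVec
  | [] => []
  | (s, c) :: D => forceNat (16 ^ 3 * (s / 16 ^ 5) + s % 16 ^ 3) fun s' => (s', c) :: dropMiddle D

/-- One step of the transfer recursion. -/
noncomputable def transferStep (D : SparseVec) : SparseVec :=
  dropMiddle (keepLe (16 ^ 3) 0 (keepLe (16 ^ 4) 0
    (runE [(3, 6), (4, 6), (5, 6), (3, 7), (4, 7), (5, 7), (6, 7)] [(0, 1), (2, 5), (6, 7)]
      (setHigh 67 D))))

/-- The start of the transfer recursion. -/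
noncomputable def transferInit : SparseVec :=
  runE closingEdges [(0, 1), (2, 3), (4, 5)] [(14248268852, 1)]

/-- The end of the transfer recursion. -/
noncomputable def transferFinal (D : SparseVec) : SparseVec :=
  runE [(3, 6), (4, 6), (5, 6), (3, 0), (4, 0), (5, 0), (6, 0), (5, 1), (6, 1), (0, 1), (5, 2),
    (6, 2), (0, 2), (1, 2)] [] (setHigh 3 D)

theorem mem_pathEdges {k : ℕ} {p : ℕ × ℕ} :
    p ∈ pathEdges k ↔ ∃ j < k, ∃ q ∈ pathBlock, p = (q.1 + 2 * j, q.2 + 2 * j) := by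
  induction k generalizing p with
  | zero => simp [pathEdges]
  | succ k ih =>
    simp only [pathEdges, List.mem_append, renamePairs, List.mem_map, ih]
    constructor
    · rintro (h | ⟨q, ⟨j, hj, r, hr, rfl⟩, rfl⟩)
      · exact ⟨0, by omega, p, h, rfl⟩
      · exact ⟨j + 1, by omega, r, hr, rfl⟩
    · rintro ⟨_ | j, hj, q, hq, rfl⟩
      · exact Or.inl hq
      · exact Or.inr ⟨_, ⟨j, by omega, q, hq, rfl⟩, rfl⟩

theorem pathEdges_le {k : ℕ} {p : ℕ × ℕ} (hp : p ∈ pathEdges k) :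
    p.1 ≤ 2 * k + 2 ∧ p.2 ≤ 2 * k + 2 := by
  obtain ⟨j, hj, q, hq, rfl⟩ := mem_pathEdges.mp hp
  have : ∀ q ∈ pathBlock, q.1 ≤ 4 ∧ q.2 ≤ 4 := by decide
  have := this q hq
  dsimp only
  omega

theorem orientCoeff_renamePairs_add_two (E : List (ℕ × ℕ)) (m : ℕ → ℕ) (h0 : m 0 = 0) (h1 : m 1 = 0) :
    orientCoeff (renamePairs (· + 2) E) m = orientCoeff E fun i => m (i + 2) := by
  induction E generalizing m with
  | nil =>
    have : m = 0 ↔ (fun i => m (i + 2)) = 0 := by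
      constructor
      · rintro rfl
        rfl
      · intro h
        funext i
        rcases i with _ | _ | i
        · exact h0
        · exact h1
        · exact congrFun h i
    simp only [renamePairs, List.map_nil, orientCoeff]
    by_cases h : m = 0
    · rw [if_pos h, if_pos (this.mp h)]
    · rw [if_neg h, if_neg fun h' => h (this.mpr h')]
  | cons p E ih =>
    obtain ⟨a, b⟩ := p
    have hu : ∀ a x, (fun i => Function.update m (a + 2) x (i + 2)) =
        Function.update (fun i => m (i + 2)) a x := by
      intro a x
      funext i
      by_cases h : i = a
      · subst h; simp
      · rw [Function.update_of_ne h, Function.update_of_ne (by omega)]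
    have hi : ∀ a x, orientCoeff (renamePairs (· + 2) E) (Function.update m (a + 2) x) =
        orientCoeff E (Function.update (fun i => m (i + 2)) a x) := by
      intro a x
      rw [ih, hu]
      · rwa [Function.update_of_ne (by omega)]
      · rwa [Function.update_of_ne (by omega)]
    simp only [renamePairs, List.map_cons, orientCoeff] at hi ⊢
    rw [hi, hi]

theorem pathWindow_injOn {k W : ℕ} (hk : 2 ≤ k) : Set.InjOn (pathWindow k) (Set.Iio W) := by
  intro a _ b _ h
  unfold pathWindow at h
  grind

theorem digits_mod_add {s x a : ℕ} :
    digits (16 ^ 6 * x + s % 16 ^ 6) a = if a < 6 then digits s a else digits x (a - 6) := by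
  unfold digits
  split_ifs with h
  · obtain ⟨b, hb⟩ := Nat.exists_eq_add_of_lt h
    interval_cases a <;> omega
  · obtain ⟨b, rfl⟩ := Nat.exists_eq_add_of_le (not_lt.mp h)
    rw [pow_add, ← Nat.div_div_eq_div_mul, Nat.mul_add_div (by norm_num),
      Nat.div_eq_of_lt (Nat.mod_lt _ (by norm_num)), add_zero, Nat.add_sub_cancel_left]

theorem digits_dropMiddle {s a : ℕ} :
    digits (16 ^ 3 * (s / 16 ^ 5) + s % 16 ^ 3) a =
      if a < 3 then digits s a else digits s (a + 2) := by
  unfold digits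
  split_ifs with h
  · interval_cases a <;> omega
  · obtain ⟨b, rfl⟩ := Nat.exists_eq_add_of_le (not_lt.mp h)
    rw [pow_add, ← Nat.div_div_eq_div_mul, Nat.mul_add_div (by norm_num),
      Nat.div_eq_of_lt (Nat.mod_lt _ (by norm_num)), add_zero,
      show 3 + b + 2 = 5 + b by ring, pow_add 16 5 b, ← Nat.div_div_eq_div_mul]

theorem pair_setHigh (I : ℕ → ZMod 1009) (x : ℕ) (D : SparseVec) :
    SparseVec.pair I (setHigh x D) =
      SparseVec.pair (fun s => I (16 ^ 6 * x + s % 16 ^ 6)) D := by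
  induction D with
  | nil => rfl
  | cons p D ih =>
    obtain ⟨s, c⟩ := p
    rw [setHigh, forceNat_eq, SparseVec.pair_cons, SparseVec.pair_cons, ih]

theorem pair_dropMiddle (I : ℕ → ZMod 1009) (D : SparseVec) :
    SparseVec.pair I (dropMiddle D) =
      SparseVec.pair (fun s => I (16 ^ 3 * (s / 16 ^ 5) + s % 16 ^ 3)) D := by
  induction D with
  | nil => rfl
  | cons p D ih =>
    obtain ⟨s, c⟩ := p
    rw [dropMiddle, forceNat_eq, SparseVec.pair_cons, SparseVec.pair_cons, ih]

theorem mem_keepLe {w m : ℕ} {D : SparseVec} {p : ℕ × ℕ} (h : p ∈ keepLe w m D) :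
    p ∈ D ∧ p.1 / w % 16 ≤ m := by
  induction D with
  | nil => exact absurd h List.not_mem_nil
  | cons q D ih =>
    obtain ⟨s, c⟩ := q
    rw [keepLe_cons] at h
    split at h
    · next h0 =>
      rcases List.mem_cons.mp h with rfl | h
      · exact ⟨List.mem_cons_self, h0⟩
      · exact ⟨List.mem_cons_of_mem _ (ih h).1, (ih h).2⟩
    · exact ⟨List.mem_cons_of_mem _ (ih h).1, (ih h).2⟩

/-- The window at the ends of a path together with the two vertices `3, 4`. -/
def stepWindow (k a : ℕ) : ℕ := if a < 6 then pathWindow k a else a - 3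

theorem pathCoeff_succ {k : ℕ} (hk : 2 ≤ k) (D : SparseVec) :
    SparseVec.pair (pathCoeff (k + 1)) D = SparseVec.pair (pathCoeff k) (transferStep D) := by
  have hρ6 := pathWindow_injOn (W := 6) hk
  have hρ6' := pathWindow_injOn (k := k + 1) (W := 6) (by omega)
  have hρ : Set.InjOn (stepWindow (k + 1)) (Set.Iio 8) := by
    intro a ha b hb h
    simp only [Set.mem_Iio] at ha hb
    simp only [stepWindow, pathWindow] at h
    grind
  have h34 : ∀ a, a = 3 ∨ a = 4 → ∀ s, 0 < digits s a →
      windowCoeff 8 (stepWindow (k + 1)) (pathExp (k + 1))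
        (renamePairs (· + 2) (pathEdges k)) s = 0 := by
    intro a ha s hs
    rw [windowCoeff, orientCoeff_eq_zero (i := stepWindow (k + 1) a), Int.cast_zero]
    rw [windowExp_apply hρ s (by omega), countAt_eq_zero.mpr]
    · exact hs
    · intro p hp
      obtain ⟨q, -, rfl⟩ := List.mem_map.mp hp
      simp only [stepWindow, pathWindow]
      rcases ha with rfl | rfl <;> constructor <;> simp
  rw [transferStep, pair_dropMiddle]
  trans SparseVec.pair
      (windowCoeff 8 (stepWindow (k + 1)) (pathExp (k + 1)) (renamePairs (· + 2) (pathEdges k)))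
      (keepLe (16 ^ 3) 0 (keepLe (16 ^ 4) 0
    (runE [(3, 6), (4, 6), (5, 6), (3, 7), (4, 7), (5, 7), (6, 7)] [(0, 1), (2, 5), (6, 7)]
      (setHigh 67 D))))
  swap
  · refine SparseVec.pair_congr _ fun p hp => ?_
    have h3 : digits p.1 3 = 0 := Nat.le_zero.mp (mem_keepLe hp).2
    have h4 : digits p.1 4 = 0 := Nat.le_zero.mp (mem_keepLe (mem_keepLe hp).1).2
    rw [pathCoeff, windowCoeff, windowCoeff, orientCoeff_renamePairs_add_two]
    · congr 2
      symm
      refine windowExp_eq hρ6 (fun a ha => ?_) fun j hj => ?_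
      · rw [digits_dropMiddle]
        split_ifs with ha3
        · have : pathWindow k a + 2 = stepWindow (k + 1) a := by
            simp only [stepWindow, pathWindow]; grind
          rw [this, windowExp_apply hρ _ (by omega)]
        · have : pathWindow k a + 2 = stepWindow (k + 1) (a + 2) := by
            simp only [stepWindow, pathWindow]; grind
          rw [this, windowExp_apply hρ _ (by omega)]
      · have hj' : 2 < j ∧ (j < 2 * k ∨ 2 * k + 2 < j) := by
          have h0 := hj 0 (by norm_num)
          have h1 := hj 1 (by norm_num)
          have h2 := hj 2 (by norm_num)
          have h3 := hj 3 (by norm_num)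
          have h4 := hj 4 (by norm_num)
          have h5 := hj 5 (by norm_num)
          simp [pathWindow] at h0 h1 h2 h3 h4 h5
          omega
        rw [windowExp_of_ne]
        · unfold pathExp
          grind
        · intro a ha
          simp only [stepWindow, pathWindow]
          grind
    · exact (windowExp_apply hρ p.1 (a := 3) (by norm_num)).trans h3
    · exact (windowExp_apply hρ p.1 (a := 4) (by norm_num)).trans h4
  · rw [SparseVec.pair_keepLe _ 3 0 (h34 3 (by simp)),
      SparseVec.pair_keepLe _ 4 0 (h34 4 (by simp)),
      pair_runE hρ, pair_setHigh]
    · refine SparseVec.pair_congr _ fun p hp => ?_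
      rw [pathCoeff, windowCoeff, windowCoeff]
      have hE : renamePairs (stepWindow (k + 1))
          [(3, 6), (4, 6), (5, 6), (3, 7), (4, 7), (5, 7), (6, 7)] ++
            renamePairs (· + 2) (pathEdges k) = pathEdges (k + 1) := rfl
      rw [hE]
      congr 2
      refine windowExp_eq hρ6' (fun a ha => ?_) fun j hj => ?_
      · have : pathWindow (k + 1) a = stepWindow (k + 1) a := by simp [stepWindow, ha]
        rw [this, windowExp_apply hρ _ (by omega), digits_mod_add, if_pos ha]
      · by_cases h3 : j = 3
        · subst h3
          have hd : digits (16 ^ 6 * 67 + p.1 % 16 ^ 6) 6 = 3 := by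
            rw [digits_mod_add, if_neg (by norm_num)]
            decide
          have : pathExp (k + 1) 3 = 3 := by
            rw [pathExp, if_pos (by omega)]
            decide
          rw [this]
          exact (windowExp_apply hρ _ (a := 6) (by norm_num)).trans hd
        by_cases h4 : j = 4
        · subst h4
          have hd : digits (16 ^ 6 * 67 + p.1 % 16 ^ 6) 7 = 4 := by
            rw [digits_mod_add, if_neg (by norm_num)]
            decide
          have : pathExp (k + 1) 4 = 4 := by
            rw [pathExp, if_pos (by omega)]
            decide
          rw [this]
          exact (windowExp_apply hρ _ (a := 7) (by norm_num)).trans hd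
        rw [windowExp_of_ne]
        intro a ha
        by_cases ha6 : a < 6
        · rw [stepWindow, if_pos ha6]
          exact hj a ha6
        · simp only [stepWindow]
          grind
    · decide
    · intro a ha hF p hp
      obtain ⟨q, -, rfl⟩ := List.mem_map.mp hp
      have : a = 3 ∨ a = 4 := by
        clear hp
        interval_cases a <;> first | (simp; done) | exact absurd hF (by decide)
      simp only [stepWindow, pathWindow]
      rcases this with rfl | rfl <;> constructor <;> simp

theorem pathCoeff_two (D : SparseVec) {c : ℕ} (h : transferFinal D = [(0, c)]) :
    SparseVec.pair (pathCoeff 2) D = c := by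
  obtain ⟨ρ, hρ_def⟩ : ∃ ρ : ℕ → ℕ, ρ = fun a => if a < 6 then pathWindow 2 a else 3 := ⟨_, rfl⟩
  have hρ : Set.InjOn ρ (Set.Iio 7) := by
    intro a ha b hb h
    simp only [Set.mem_Iio] at ha hb
    simp only [hρ_def, pathWindow] at h
    grind
  have key := pair_runE (bg := 0) hρ [(3, 6), (4, 6), (5, 6), (3, 0), (4, 0), (5, 0), (6, 0), (5, 1),
    (6, 1), (0, 1), (5, 2), (6, 2), (0, 2), (1, 2)] [] [] (by decide) (by simp) (setHigh 3 D)
  unfold transferFinal at h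
  rw [h, pair_setHigh] at key
  have hE : renamePairs ρ [(3, 6), (4, 6), (5, 6), (3, 0), (4, 0), (5, 0), (6, 0), (5, 1), (6, 1),
      (0, 1), (5, 2), (6, 2), (0, 2), (1, 2)] ++ [] = pathEdges 2 := by rw [hρ_def]; decide
  have h0 : windowExp 7 ρ 0 0 = 0 := windowExp_eq hρ
    (fun a _ => by rw [digits_zero]; rfl) fun _ _ => rfl
  rw [hE, SparseVec.pair_cons, SparseVec.pair_nil, windowCoeff, h0, orientCoeff] at key
  simp only [if_true, Int.cast_one, mul_one, add_zero] at key
  rw [key]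
  refine SparseVec.pair_congr _ fun p hp => ?_
  rw [pathCoeff, windowCoeff, windowCoeff]
  have hw : windowExp 6 (pathWindow 2) (pathExp 2) p.1 =
      windowExp 7 ρ 0 (16 ^ 6 * 3 + p.1 % 16 ^ 6) := ?_
  · rw [hw]
  refine windowExp_eq (pathWindow_injOn le_rfl) (fun a ha => ?_) fun j hj => ?_
  · have : pathWindow 2 a = ρ a := by simp [hρ_def, ha]
    rw [this, windowExp_apply hρ _ (by omega), digits_mod_add, if_pos ha]
  · by_cases h3 : j = 3
    · have e : j = ρ 6 := by rw [h3, hρ_def]; rfl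
      have hd : pathExp 2 3 = digits 3 (6 - 6) := by decide
      rw [e, windowExp_apply hρ _ (by norm_num), digits_mod_add, ← e, h3, if_neg (by norm_num), hd]
    have hj' : 6 < j := by
      have h0 := hj 0 (by norm_num)
      have h1 := hj 1 (by norm_num)
      have h2 := hj 2 (by norm_num)
      have h3 := hj 3 (by norm_num)
      have h4 := hj 4 (by norm_num)
      have h5 := hj 5 (by norm_num)
      simp [pathWindow] at h0 h1 h2 h3 h4 h5
      omega
    rw [windowExp_of_ne]
    · unfold pathExp
      rw [if_neg (by omega)]
      rfl
    · intro a ha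
      rw [hρ_def]
      simp only [pathWindow]
      grind

theorem cycle_eq_pair {k : ℕ} (hk : 2 ≤ k) :
    (orientCoeff (cycleEdges k) (cycleExp k) : ZMod 1009) =
      SparseVec.pair (pathCoeff k) transferInit := by
  have hρ := pathWindow_injOn (W := 9) hk
  trans SparseVec.pair (windowCoeff 9 (pathWindow k) (pathExp k) (pathEdges k)) transferInit
  · rw [transferInit, pair_runE hρ]
    · rw [SparseVec.pair_cons, SparseVec.pair_nil]
      simp [windowCoeff, cycleEdges, cycleExp]
    · decide
    · intro a ha hF p hp
      have : 6 ≤ a := by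
        clear hp
        interval_cases a <;> first | (simp; done) | exact absurd hF (by decide)
      have := pathEdges_le hp
      simp only [pathWindow]
      grind
  · refine SparseVec.pair_congr _ fun p hp => ?_
    have hp6 : p.1 < 16 ^ 6 := by
      have : ∀ p ∈ transferInit, p.1 < 16 ^ 6 := by decide +kernel
      exact this p hp
    rw [pathCoeff, windowCoeff, windowCoeff]
    congr 2
    symm
    refine windowExp_eq (pathWindow_injOn hk) (fun a ha => ?_) fun j hj => ?_
    · rw [windowExp_apply hρ _ (by omega)]
    · by_cases hj' : ∃ a, 6 ≤ a ∧ a < 9 ∧ pathWindow k a = j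
      · obtain ⟨a, ha, ha9, rfl⟩ := hj'
        rw [windowExp_apply hρ _ ha9, digits_eq_zero hp6 ha]
        have : ¬ (2 < pathWindow k a ∧ pathWindow k a < 2 * k) := by
          simp only [pathWindow]
          grind
        rw [pathExp, if_neg this]
      · rw [windowExp_of_ne]
        intro a ha e
        by_cases ha6 : a < 6
        · exact hj a ha6 e
        · exact hj' ⟨a, not_lt.mp ha6, ha, e⟩

theorem pair_pathCoeff_add {k : ℕ} (j : ℕ) (D : SparseVec) (hk : 2 ≤ k) :
    SparseVec.pair (pathCoeff (k + j)) D = SparseVec.pair (pathCoeff k) (transferStep^[j] D) := by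
  induction j generalizing D with
  | zero => rfl
  | succ j ih =>
    rw [← add_assoc, pathCoeff_succ (by omega), ih, Function.iterate_succ_apply]

/-- Whether the recursion ends with a nonzero number modulo `1009`. -/
def isNonzeroScalar : SparseVec → Bool
  | [(0, c)] => Nat.blt 0 c && Nat.blt c 1009
  | _ => false

theorem transferStep_periodic : transferStep^[11] transferInit = transferStep^[5] transferInit := by
  decide +kernel

theorem isNonzeroScalar_transferFinal (j : ℕ) (hj : 2 ≤ j) :
    isNonzeroScalar (transferFinal (transferStep^[j] transferInit)) = true := by
  induction j using Nat.strong_induction_on with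
  | _ j ih =>
    by_cases h : j < 11
    · have : ∀ j < 11, 2 ≤ j →
          isNonzeroScalar (transferFinal (transferStep^[j] transferInit)) = true := by
        decide +kernel
      exact this j h hj
    · obtain ⟨i, rfl⟩ := Nat.exists_eq_add_of_le' (not_lt.mp h)
      rw [Function.iterate_add_apply, transferStep_periodic, ← Function.iterate_add_apply]
      exact ih (i + 5) (by omega) (by omega)

theorem orientCoeff_cycleEdges_ne_zero {k : ℕ} (hk : 4 ≤ k) :
    orientCoeff (cycleEdges k) (cycleExp k) ≠ 0 := by
  intro h0
  have h := cycle_eq_pair (k := k) (by omega)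
  obtain ⟨j, rfl⟩ := Nat.exists_eq_add_of_le (show 2 ≤ k by omega)
  rw [pair_pathCoeff_add j _ le_rfl, h0, Int.cast_zero] at h
  have hj := isNonzeroScalar_transferFinal j (by omega)
  generalize hD : transferStep^[j] transferInit = D at h hj
  unfold isNonzeroScalar at hj
  split at hj
  · next c hc =>
    rw [pathCoeff_two D hc] at h
    simp only [Bool.and_eq_true, Nat.blt_eq] at hj
    have := (ZMod.natCast_eq_zero_iff c 1009).mp h.symm
    exact absurd (Nat.le_of_dvd hj.1 this) (by omega)
  · exact absurd hj (by simp)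

theorem cycleExp_le {k : ℕ} (hk : 2 ≤ k) (i : ℕ) :
    cycleExp k i ≤ (if i % 2 = 0 then 5 else 3) ∧ (2 * k + 6 ≤ i → cycleExp k i = 0) := by
  have hρ := pathWindow_injOn (W := 9) hk
  unfold cycleExp
  by_cases h : ∃ a < 9, pathWindow k a = i
  · obtain ⟨a, ha, rfl⟩ := h
    rw [windowExp_apply hρ _ ha]
    refine ⟨?_, fun h => absurd h ?_⟩
    · have : ∀ a < 9, digits 14248268852 a ≤
          if (if a < 3 then a else if a < 6 then a - 3 else a - 3) % 2 = 0 then 5 else 3 := by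
        decide
      refine (this a ha).trans_eq ?_
      unfold pathWindow
      congr 2
      grind
    · unfold pathWindow
      grind
  · rw [windowExp_of_ne _ fun a ha e => h ⟨a, ha, e⟩]
    unfold pathExp
    grind

end Periodic

section Extension

open Classical

variable {V : Type*} {G : SimpleGraph V} {L : Sym2 V → Finset ℕ}

/-- Two distinct edges at distance at most two. -/
def EdgesNear (G : SimpleGraph V) (e f : Sym2 V) : Prop :=
  e ≠ f ∧ ∃ x ∈ e, ∃ y ∈ f, x = y ∨ G.Adj x y

theorem EdgesNear.symm {e f : Sym2 V} (h : EdgesNear G e f) : EdgesNear G f e := by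
  obtain ⟨hne, x, hx, y, hy, h⟩ := h
  exact ⟨hne.symm, y, hy, x, hx, h.imp Eq.symm fun h => h.symm⟩

/-- The edges in `A` can be coloured from their lists, such that edges at distance at most two
in `G` get distinct colours. -/
def Colourable (G : SimpleGraph V) (L : Sym2 V → Finset ℕ) (A : Finset (Sym2 V)) : Prop :=
  ∃ φ : Sym2 V → ℕ, (∀ e ∈ A, φ e ∈ L e) ∧ ∀ e ∈ A, ∀ f ∈ A, EdgesNear G e f → φ e ≠ φ f

theorem Colourable.mono {A B : Finset (Sym2 V)} (h : Colourable G L B) (hAB : A ⊆ B) :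
    Colourable G L A := by
  obtain ⟨φ, h1, h2⟩ := h
  exact ⟨φ, fun e he => h1 e (hAB he), fun e he f hf => h2 e (hAB he) f (hAB hf)⟩

variable [Fintype V]

/-- The members of `A` at distance at most two from `e`. -/
noncomputable def nearIn (G : SimpleGraph V) (A : Finset (Sym2 V)) (e : Sym2 V) :
    Finset (Sym2 V) := A.filter fun f => EdgesNear G e f

/-- The neighbours of a vertex. -/
noncomputable def nbr (G : SimpleGraph V) (v : V) : Finset V :=
  Finset.univ.filter fun w => G.Adj v w

/-- The number of members of `A` at a vertex. -/
noncomputable def degIn (A : Finset (Sym2 V)) (v : V) : ℕ := (A.filter fun e => v ∈ e).card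

/-- All edges of `G`. -/
noncomputable def edges (G : SimpleGraph V) : Finset (Sym2 V) :=
  Finset.univ.filter fun e => e ∈ G.edgeSet

/-- The edges of `G` with no end in `R`. -/
noncomputable def edgesAvoiding (G : SimpleGraph V) (R : Finset V) : Finset (Sym2 V) :=
  (edges G).filter fun e => ∀ v ∈ e, v ∉ R

@[simp] theorem mem_nbr {v w : V} : w ∈ nbr G v ↔ G.Adj v w := by simp [nbr]

@[simp] theorem mem_edges {e : Sym2 V} : e ∈ edges G ↔ e ∈ G.edgeSet := by simp [edges]

theorem card_nbr_sdiff {u v : V} (h : G.Adj u v) :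
    (nbr G u \ {v}).card = (nbr G u).card - 1 := by
  rw [Finset.card_sdiff_of_subset (by simpa using h), Finset.card_singleton]

/-- Extension of a colouring by the combinatorial Nullstellensatz. -/
theorem Colourable.union_image {A : Finset (Sym2 V)} (hA : Colourable G L A) {N : ℕ}
    (x : ℕ → Sym2 V) (E : List (ℕ × ℕ)) (m : ℕ → ℕ) (hE : ∀ p ∈ E, p.1 < N ∧ p.2 < N)
    (hm : ∀ i, N ≤ i → m i = 0) (h : orientCoeff E m ≠ 0)
    (hx : ∀ i < N, ∀ j < N, x i = x j → i = j) (hxA : ∀ i < N, x i ∉ A)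
    (hnear : ∀ i j, i < j → j < N → EdgesNear G (x i) (x j) → (i, j) ∈ E ∨ (j, i) ∈ E)
    (hcard : ∀ i < N, (nearIn G A (x i)).card + m i < (L (x i)).card) :
    Colourable G L (A ∪ (Finset.range N).image x) := by
  obtain ⟨φ, h1, h2⟩ := hA
  obtain ⟨c, hc1, hc2⟩ := exists_coloring_of_orientCoeff_ne_zero E m hE hm h
    (fun i => L (x i) \ (nearIn G A (x i)).image φ) (by
      intro i hi
      have := Finset.le_card_sdiff ((nearIn G A (x i)).image φ) (L (x i))
      have := Finset.card_image_le (s := nearIn G A (x i)) (f := φ)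
      have := hcard i hi
      omega)
  have hc3 : ∀ i j, i < j → j < N → EdgesNear G (x i) (x j) → c i ≠ c j := by
    intro i j hij hj hn
    rcases hnear i j hij hj hn with hp | hp
    · exact hc2 _ hp
    · exact (hc2 _ hp).symm
  have hc4 : ∀ i < N, ∀ f ∈ A, EdgesNear G (x i) f → c i ≠ φ f := by
    intro i hi f hf hn heq
    have := (Finset.mem_sdiff.mp (hc1 i hi)).2
    exact this (Finset.mem_image.mpr ⟨f, Finset.mem_filter.mpr ⟨hf, hn⟩, heq.symm⟩)
  let ψ : Sym2 V → ℕ := fun e =>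
    if e ∈ A then φ e else if h : ∃ i, i < N ∧ x i = e then c h.choose else 0
  have hψA : ∀ e ∈ A, ψ e = φ e := fun e he => if_pos he
  have hψx : ∀ i < N, ψ (x i) = c i := by
    intro i hi
    have hex : ∃ j, j < N ∧ x j = x i := ⟨i, hi, rfl⟩
    simp only [ψ]
    rw [if_neg (hxA i hi), dif_pos hex]
    congr 1
    exact hx _ hex.choose_spec.1 _ hi hex.choose_spec.2
  refine ⟨ψ, ?_, ?_⟩
  · intro e he
    rcases Finset.mem_union.mp he with he | he
    · rw [hψA e he]
      exact h1 e he
    · obtain ⟨i, hi, rfl⟩ := Finset.mem_image.mp he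
      rw [hψx i (Finset.mem_range.mp hi)]
      exact (Finset.mem_sdiff.mp (hc1 i (Finset.mem_range.mp hi))).1
  · intro e he f hf hn
    rcases Finset.mem_union.mp he with he | he <;> rcases Finset.mem_union.mp hf with hf | hf
    · rw [hψA e he, hψA f hf]
      exact h2 e he f hf hn
    · obtain ⟨i, hi, rfl⟩ := Finset.mem_image.mp hf
      rw [hψA e he, hψx i (Finset.mem_range.mp hi)]
      exact (hc4 i (Finset.mem_range.mp hi) e he hn.symm).symm
    · obtain ⟨i, hi, rfl⟩ := Finset.mem_image.mp he
      rw [hψA f hf, hψx i (Finset.mem_range.mp hi)]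
      exact hc4 i (Finset.mem_range.mp hi) f hf hn
    · obtain ⟨i, hi, rfl⟩ := Finset.mem_image.mp he
      obtain ⟨j, hj, rfl⟩ := Finset.mem_image.mp hf
      rw [Finset.mem_range] at hi hj
      rw [hψx i hi, hψx j hj]
      rcases lt_trichotomy i j with hij | rfl | hij
      · exact hc3 i j hij hj hn
      · exact absurd rfl hn.1
      · exact (hc3 j i hij hi hn.symm).symm

theorem Colourable.insert_edge {A : Finset (Sym2 V)} (hA : Colourable G L A) {e : Sym2 V}
    (h : (nearIn G A e).card < (L e).card) : Colourable G L (insert e A) := by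
  by_cases he : e ∈ A
  · rwa [Finset.insert_eq_of_mem he]
  have := hA.union_image (N := 1) (fun _ => e) [] 0 (by simp) (by simp) (by simp [orientCoeff])
    (by omega) (fun _ _ => he) (by omega) (fun _ _ => by simpa using h)
  refine this.mono fun f hf => ?_
  rcases Finset.mem_insert.mp hf with rfl | hf
  · exact Finset.mem_union_right _ (Finset.mem_image.mpr ⟨0, by simp, rfl⟩)
  · exact Finset.mem_union_left _ hf

/-- The number of coloured edges near an uncoloured edge. -/
theorem card_nearIn_le {A : Finset (Sym2 V)} (hA : A ⊆ edges G) {u v : V} (huv : s(u, v) ∉ A) :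
    (nearIn G A s(u, v)).card ≤ ∑ z ∈ (nbr G u ∪ nbr G v) \ {u, v}, degIn A z := by
  have hsub : nearIn G A s(u, v) ⊆
      ((nbr G u ∪ nbr G v) \ {u, v}).biUnion fun z => A.filter fun e => z ∈ e := by
    intro f hf
    obtain ⟨hfA, hne, x, hx, y, hy, h⟩ := Finset.mem_filter.mp hf
    simp only [Finset.mem_biUnion, Finset.mem_filter, Finset.mem_sdiff, Finset.mem_union, mem_nbr,
      Finset.mem_insert, Finset.mem_singleton]
    obtain ⟨z, rfl⟩ : ∃ z, f = s(y, z) := ⟨_, (Sym2.other_spec hy).symm⟩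
    have hyz : G.Adj y z := by simpa using hA hfA
    have huz : ∀ z, s(u, z) ∈ A → z ≠ v := by rintro z hz rfl; exact huv hz
    have hvz : ∀ z, s(v, z) ∈ A → z ≠ u := by
      rintro z hz rfl
      rw [Sym2.eq_swap] at hz
      exact huv hz
    by_cases hyu : y = u
    · subst hyu
      exact ⟨z, ⟨Or.inl hyz, by rintro (rfl | rfl); exacts [hyz.ne rfl, huz _ hfA rfl]⟩,
        hfA, by simp⟩
    by_cases hyv : y = v
    · subst hyv
      exact ⟨z, ⟨Or.inr hyz, by rintro (rfl | rfl); exacts [hvz _ hfA rfl, hyz.ne rfl]⟩,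
        hfA, by simp⟩
    rcases Sym2.mem_iff.mp hx with rfl | rfl
    · rcases h with rfl | h
      · exact absurd rfl hyu
      · exact ⟨y, ⟨Or.inl h, by simp [hyu, hyv]⟩, hfA, by simp⟩
    · rcases h with rfl | h
      · exact absurd rfl hyv
      · exact ⟨y, ⟨Or.inr h, by simp [hyu, hyv]⟩, hfA, by simp⟩
  exact (Finset.card_le_card hsub).trans Finset.card_biUnion_le

/-- A vertex has at most as many coloured edges as it has neighbours along edges which are not
in a set of uncoloured edges. -/
theorem degIn_add_card_le {A : Finset (Sym2 V)} (hA : A ⊆ edges G) {v : V} {S : Finset V}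
    (hS : S ⊆ nbr G v) (hSA : ∀ w ∈ S, s(v, w) ∉ A) : degIn A v + S.card ≤ (nbr G v).card := by
  have h1 : A.filter (fun e => v ∈ e) ⊆ (nbr G v \ S).image fun w => s(v, w) := by
    intro e he
    obtain ⟨heA, hve⟩ := Finset.mem_filter.mp he
    obtain ⟨z, rfl⟩ : ∃ z, e = s(v, z) := ⟨_, (Sym2.other_spec hve).symm⟩
    have hvz : G.Adj v z := by simpa using hA heA
    exact Finset.mem_image.mpr
      ⟨z, Finset.mem_sdiff.mpr ⟨mem_nbr.mpr hvz, fun h => hSA z h heA⟩, rfl⟩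
  have h2 := (Finset.card_le_card h1).trans Finset.card_image_le
  rw [Finset.card_sdiff_of_subset hS] at h2
  have := Finset.card_le_card hS
  unfold degIn
  omega

theorem degIn_le {A : Finset (Sym2 V)} (hA : A ⊆ edges G) (v : V) :
    degIn A v ≤ (nbr G v).card := by
  simpa using degIn_add_card_le hA (S := ∅) (v := v) (by simp) (by simp)

/-- If each member of `B` may be added greedily, then `A ∪ B` is colourable. -/
theorem Colourable.of_greedy {A B : Finset (Sym2 V)} (hA : Colourable G L A) (hAB : A ⊆ B)
    (h : ∀ e ∈ B, e ∉ A → ∀ A' ⊆ B, e ∉ A' → (nearIn G A' e).card < (L e).card) :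
    Colourable G L B := by
  suffices ∀ C ⊆ B \ A, Colourable G L (A ∪ C) by
    have := this (B \ A) subset_rfl
    rwa [Finset.union_sdiff_of_subset hAB] at this
  intro C
  induction C using Finset.induction_on with
  | empty => simpa using hA
  | insert e C heC ih =>
    intro hC
    have he := Finset.mem_sdiff.mp (hC (Finset.mem_insert_self e C))
    have hC' := (Finset.subset_insert e C).trans hC
    rw [Finset.union_insert]
    refine (ih hC').insert_edge (h e he.1 he.2 _ ?_ ?_)
    · exact Finset.union_subset hAB (hC'.trans Finset.sdiff_subset)
    · rw [Finset.mem_union]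
      rintro (h | h)
      · exact he.2 h
      · exact heC h

/-- Edges leaving a set of vertices of inner degree at least two may be coloured greedily. -/
theorem Colourable.of_edgesAvoiding (hG : ∀ v, (nbr G v).card ≤ 3)
    (hL : ∀ e ∈ G.edgeSet, 10 ≤ (L e).card) {R : Finset V} (hR : ∀ v ∈ R, 2 ≤ (nbr G v ∩ R).card)
    (h : Colourable G L (edgesAvoiding G R)) {B : Finset (Sym2 V)} (hB : B ⊆ edges G)
    (hBR : ∀ u ∈ R, ∀ v ∈ R, s(u, v) ∉ B) : Colourable G L B := by
  have hsub : edgesAvoiding G R ⊆ edgesAvoiding G R ∪ B := Finset.subset_union_left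
  refine (h.of_greedy (B := edgesAvoiding G R ∪ B) hsub fun e heB heA A hA heA' => ?_).mono
    Finset.subset_union_right
  have hall : edgesAvoiding G R ∪ B ⊆ edges G := Finset.union_subset (Finset.filter_subset _ _) hB
  have heG := mem_edges.mp (hall heB)
  have hRA : ∀ u ∈ R, ∀ v ∈ R, s(u, v) ∉ A := by
    intro u hu v hv huv
    rcases Finset.mem_union.mp (hA huv) with h | h
    · exact (Finset.mem_filter.mp h).2 u (by simp) hu
    · exact hBR u hu v hv h
  have heB' : e ∈ B := (Finset.mem_union.mp heB).resolve_left heA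
  obtain ⟨u, hue, hu⟩ : ∃ u ∈ e, u ∈ R := by
    by_contra! hcon
    exact heA (Finset.mem_filter.mpr ⟨hall heB, hcon⟩)
  obtain ⟨v, rfl⟩ : ∃ v, e = s(u, v) := ⟨_, (Sym2.other_spec hue).symm⟩
  have huv : G.Adj u v := by simpa using heG
  have hv : v ∉ R := fun hv => hBR u hu v hv heB'
  have hAE := hA.trans hall
  have hlt := hL _ heG
  refine lt_of_le_of_lt (card_nearIn_le hAE heA') (lt_of_lt_of_le ?_ hlt)
  have hnu : nbr G u \ {v} ⊆ nbr G u ∩ R := by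
    have h2 := hR u hu
    have h3 := hG u
    have hins : insert v (nbr G u ∩ R) ⊆ nbr G u :=
      Finset.insert_subset (mem_nbr.mpr huv) Finset.inter_subset_left
    have hcard : (insert v (nbr G u ∩ R)).card = (nbr G u ∩ R).card + 1 :=
      Finset.card_insert_of_notMem fun h => hv (Finset.mem_inter.mp h).2
    have heq := Finset.eq_of_subset_of_card_le hins (by omega)
    intro z hz
    rw [Finset.mem_sdiff, ← heq, Finset.mem_insert, Finset.mem_singleton] at hz
    exact hz.1.resolve_left hz.2
  have hsub2 : (nbr G u ∪ nbr G v) \ {u, v} ⊆ (nbr G u \ {v}) ∪ (nbr G v \ {u}) := by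
    intro z
    simp only [Finset.mem_sdiff, Finset.mem_union, Finset.mem_insert, Finset.mem_singleton]
    tauto
  have hcu : (nbr G u \ {v}).card ≤ 2 := by
    have := hG u
    have := card_nbr_sdiff huv
    omega
  have hcv : (nbr G v \ {u}).card ≤ 2 := by
    have := hG v
    have := card_nbr_sdiff huv.symm
    omega
  have hsu : ∑ z ∈ nbr G u \ {v}, degIn A z ≤ 2 := by
    refine (Finset.sum_le_card_nsmul _ _ 1 fun z hz => ?_).trans (by simpa using hcu)
    have hzR := (Finset.mem_inter.mp (hnu hz)).2
    have := degIn_add_card_le hAE (v := z) (S := nbr G z ∩ R) Finset.inter_subset_left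
      fun w hw => hRA z hzR w (Finset.mem_inter.mp hw).2
    have := hR z hzR
    have := hG z
    omega
  have hsv : ∑ z ∈ nbr G v \ {u}, degIn A z ≤ 6 := by
    refine (Finset.sum_le_card_nsmul _ _ 3 fun z hz => (degIn_le hAE z).trans (hG z)).trans ?_
    simp only [smul_eq_mul]
    omega
  calc _ ≤ ∑ z ∈ (nbr G u \ {v}) ∪ (nbr G v \ {u}), degIn A z := Finset.sum_le_sum_of_subset hsub2
    _ ≤ ∑ z ∈ nbr G u \ {v}, degIn A z + ∑ z ∈ nbr G v \ {u}, degIn A z := by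
      rw [← Finset.sum_union_inter]
      omega
    _ < 10 := by omega

/-- A vertex of degree at most two is reducible. -/
theorem Colourable.of_card_nbr_le_two (hG : ∀ v, (nbr G v).card ≤ 3)
    (hL : ∀ e ∈ G.edgeSet, 10 ≤ (L e).card) {u : V} (hu : (nbr G u).card ≤ 2)
    (h : Colourable G L (edgesAvoiding G {u})) : Colourable G L (edges G) := by
  refine h.of_greedy (Finset.filter_subset _ _) fun e he heA A hA heA' => ?_
  have heG := mem_edges.mp he
  have hue : u ∈ e := by
    by_contra hcon
    refine heA (Finset.mem_filter.mpr ⟨he, fun v hv hvu => hcon ?_⟩)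
    rwa [← Finset.mem_singleton.mp hvu]
  obtain ⟨v, rfl⟩ : ∃ v, e = s(u, v) := ⟨_, (Sym2.other_spec hue).symm⟩
  have huv : G.Adj u v := by simpa using heG
  refine lt_of_le_of_lt (card_nearIn_le hA heA') (lt_of_lt_of_le ?_ (hL _ heG))
  refine lt_of_le_of_lt (Finset.sum_le_card_nsmul _ _ 3 fun z _ =>
    (degIn_le hA z).trans (hG z)) ?_
  have hsub2 : (nbr G u ∪ nbr G v) \ {u, v} ⊆ (nbr G u \ {v}) ∪ (nbr G v \ {u}) := by
    intro z
    simp only [Finset.mem_sdiff, Finset.mem_union, Finset.mem_insert, Finset.mem_singleton]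
    tauto
  have h1 := (Finset.card_le_card hsub2).trans (Finset.card_union_le _ _)
  rw [card_nbr_sdiff huv, card_nbr_sdiff huv.symm] at h1
  have := hG v
  simp only [smul_eq_mul]
  omega

end Extension

section Template

/-- Adjacency in the graph with edge list `T`. -/
def adjT (T : List (ℕ × ℕ)) (a b : ℕ) : Bool :=
  T.any fun p => (Nat.beq p.1 a && Nat.beq p.2 b) || (Nat.beq p.1 b && Nat.beq p.2 a)

/-- The degree of `a` in the graph with edge list `T` on the first `M` natural numbers. -/
def degT (M : ℕ) (T : List (ℕ × ℕ)) (a : ℕ) : ℕ := ((List.range M).filter (adjT T a)).length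

/-- Whether two pairs intersect or are joined by a member of `T`. -/
def nearT (T : List (ℕ × ℕ)) (q q' : ℕ × ℕ) : Bool :=
  [q.1, q.2].any fun a => [q'.1, q'.2].any fun b => Nat.beq a b || adjT T a b

/-- The conflict graph of the edges in the list `F`. -/
def nearPairs (T F : List (ℕ × ℕ)) : List (ℕ × ℕ) :=
  (List.range F.length).flatMap fun j =>
    ((List.range j).filter fun i => nearT T (F.getD i (0, 0)) (F.getD j (0, 0))).map fun i => (i, j)

/-- Whether `c` is a neighbour of an end of `q` which is not an end of `q`. -/
def besideT (T : List (ℕ × ℕ)) (q : ℕ × ℕ) (c : ℕ) : Bool :=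
  (adjT T q.1 c || adjT T q.2 c) && !Nat.beq q.1 c && !Nat.beq q.2 c

/-- A bound on the number of edges not in `F` at distance at most two from `q`. -/
def boundT (M : ℕ) (T F : List (ℕ × ℕ)) (q : ℕ × ℕ) : ℕ :=
  (((List.range M).filter (besideT T q)).map fun c => 3 - degT M F c).sum +
    3 * (3 - degT M T q.1) + 3 * (3 - degT M T q.2)

/-- The code `s` witnesses that the first `r` vertices of the induced subgraph `T`, with `F` the
list of edges to be coloured last, are reducible. -/
def Reducible (M r : ℕ) (T F : List (ℕ × ℕ)) (s : ℕ) : Prop :=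
  r ≤ M ∧ (∀ q ∈ F, q.1 < q.2 ∧ q.2 < M ∧ adjT T q.1 q.2 = true) ∧ F.Nodup ∧
    (∀ a < r, 2 ≤ degT r T a) ∧
    (∀ a < r, ∀ b < r, a < b ∧ adjT T a b = true → (a, b) ∈ F) ∧
    (∀ i < F.length, boundT M T F (F.getD i (0, 0)) + digits s i < 10) ∧
    coeffTest F.length (nearPairs T F) s = true

noncomputable instance (M r : ℕ) (T F : List (ℕ × ℕ)) (s : ℕ) :
    Decidable (Reducible M r T F s) := by
  unfold Reducible
  infer_instance

theorem adjT_iff {T : List (ℕ × ℕ)} {a b : ℕ} :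
    adjT T a b = true ↔ (a, b) ∈ T ∨ (b, a) ∈ T := by
  simp only [adjT, List.any_eq_true, Bool.or_eq_true, Bool.and_eq_true, Nat.beq_eq]
  constructor
  · rintro ⟨⟨c, d⟩, h, ⟨rfl, rfl⟩ | ⟨rfl, rfl⟩⟩
    · exact Or.inl h
    · exact Or.inr h
  · rintro (h | h)
    · exact ⟨_, h, Or.inl ⟨rfl, rfl⟩⟩
    · exact ⟨_, h, Or.inr ⟨rfl, rfl⟩⟩

open Classical

variable {V : Type*} [Fintype V] {G : SimpleGraph V} {L : Sym2 V → Finset ℕ}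

/-- The image of the numbers below `M` satisfying a test. -/
noncomputable def imageFilter (p : ℕ → V) (M : ℕ) (f : ℕ → Bool) : Finset V :=
  ((List.range M).filter f).toFinset.image p

theorem mem_imageFilter {p : ℕ → V} {M : ℕ} {f : ℕ → Bool} {v : V} :
    v ∈ imageFilter p M f ↔ ∃ a < M, f a = true ∧ p a = v := by
  simp [imageFilter, and_assoc]

theorem card_imageFilter {p : ℕ → V} {M : ℕ} (hp : Set.InjOn p (Set.Iio M)) (f : ℕ → Bool) :
    (imageFilter p M f).card = ((List.range M).filter f).length := by
  rw [imageFilter, Finset.card_image_of_injOn,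
    List.toFinset_card_of_nodup (List.nodup_range.filter _)]
  refine hp.mono fun a ha => ?_
  simp at ha
  exact ha.1

theorem sum_imageFilter {p : ℕ → V} {M : ℕ} (hp : Set.InjOn p (Set.Iio M)) (f : ℕ → Bool)
    (g : V → ℕ) :
    ∑ z ∈ imageFilter p M f, g z = (((List.range M).filter f).map fun c => g (p c)).sum := by
  rw [imageFilter, Finset.sum_image, List.sum_toFinset _ (List.nodup_range.filter _)]
  refine hp.mono fun a ha => ?_
  simp at ha
  exact ha.1

theorem Reducible.colourable {M r : ℕ} {T F : List (ℕ × ℕ)} {s : ℕ} (h : Reducible M r T F s)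
    (hG : ∀ v, (nbr G v).card ≤ 3) (hL : ∀ e ∈ G.edgeSet, 10 ≤ (L e).card)
    (hIH : ∀ R : Finset V, (∃ v ∈ R, 1 ≤ (nbr G v).card) → Colourable G L (edgesAvoiding G R))
    (hr0 : 0 < r)
    {p : ℕ → V} (hp : Set.InjOn p (Set.Iio M))
    (hadj : ∀ a < M, ∀ b < M, G.Adj (p a) (p b) ↔ adjT T a b = true) :
    Colourable G L (edges G) := by
  obtain ⟨hrM, hF, hnd, hr2, hrF, hbd, hs⟩ := h
  have hinj : ∀ a < M, ∀ b < M, p a = p b → a = b := fun a ha b hb e => hp ha hb e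
  let x : ℕ → Sym2 V := fun i => s(p (F.getD i (0, 0)).1, p (F.getD i (0, 0)).2)
  have hmem : ∀ i < F.length, F.getD i (0, 0) ∈ F := by
    intro i hi
    rw [List.getD_eq_getElem _ _ hi]
    exact List.getElem_mem hi
  have hxF : ∀ q ∈ F, s(p q.1, p q.2) ∈ (Finset.range F.length).image x := by
    intro q hq
    obtain ⟨i, hi, rfl⟩ := List.getElem_of_mem hq
    refine Finset.mem_image.mpr ⟨i, Finset.mem_range.mpr hi, ?_⟩
    simp only [x]
    rw [List.getD_eq_getElem _ _ hi]
  have hxG : ∀ i < F.length, x i ∈ edges G := by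
    intro i hi
    have := hF _ (hmem i hi)
    simp only [x, mem_edges, SimpleGraph.mem_edgeSet]
    exact (hadj _ (by omega) _ this.2.1).mpr this.2.2
  have hxinj : ∀ i < F.length, ∀ j < F.length, x i = x j → i = j := by
    intro i hi j hj hij
    have h1 := hF _ (hmem i hi)
    have h2 := hF _ (hmem j hj)
    have : F.getD i (0, 0) = F.getD j (0, 0) := by
      rcases Sym2.eq_iff.mp hij with ⟨e1, e2⟩ | ⟨e1, e2⟩
      · exact Prod.ext (hinj _ (by omega) _ (by omega) e1) (hinj _ (by omega) _ (by omega) e2)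
      · have e1 := hinj _ (by omega) _ (by omega) e1
        have e2 := hinj _ (by omega) _ (by omega) e2
        omega
    rw [List.getD_eq_getElem _ _ hi, List.getD_eq_getElem _ _ hj] at this
    exact (hnd.getElem_inj_iff).mp this
  obtain ⟨A, hA⟩ : ∃ A, A = edges G \ (Finset.range F.length).image x := ⟨_, rfl⟩
  have hAG : A ⊆ edges G := hA ▸ Finset.sdiff_subset
  have hFA : ∀ a b, adjT F a b = true → s(p a, p b) ∉ A := by
    intro a b hab
    rw [hA, Finset.mem_sdiff, not_and_not_right]
    intro _
    rcases adjT_iff.mp hab with h | h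
    · exact hxF _ h
    · rw [Sym2.eq_swap]
      exact hxF _ h
  have hFT : ∀ a b, adjT F a b = true → a < M ∧ b < M ∧ G.Adj (p a) (p b) := by
    intro a b hab
    rcases adjT_iff.mp hab with h | h
    · have := hF _ h
      exact ⟨by omega, this.2.1, (hadj _ (by omega) _ this.2.1).mpr this.2.2⟩
    · have := hF _ h
      exact ⟨this.2.1, by omega, ((hadj _ (by omega) _ this.2.1).mpr this.2.2).symm⟩
  have hgood : Colourable G L A := by
    refine Colourable.of_edgesAvoiding hG hL (R := (Finset.range r).image p) ?_ (hIH _ ?_) hAG ?_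
    · intro v hv
      obtain ⟨a, ha, rfl⟩ := Finset.mem_image.mp hv
      rw [Finset.mem_range] at ha
      have hsub : imageFilter p r (adjT T a) ⊆ nbr G (p a) ∩ (Finset.range r).image p := by
        intro v hv
        obtain ⟨b, hb, hab, rfl⟩ := mem_imageFilter.mp hv
        exact Finset.mem_inter.mpr ⟨mem_nbr.mpr ((hadj _ (by omega) _ (by omega)).mpr hab),
          Finset.mem_image.mpr ⟨b, Finset.mem_range.mpr hb, rfl⟩⟩
      have := Finset.card_le_card hsub
      rw [card_imageFilter (hp.mono fun b hb => lt_of_lt_of_le hb hrM)] at this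
      exact (hr2 a ha).trans this
    · refine ⟨p 0, Finset.mem_image.mpr ⟨0, Finset.mem_range.mpr hr0, rfl⟩, ?_⟩
      have h2 := hr2 0 hr0
      obtain ⟨b, hb⟩ := List.exists_mem_of_length_pos (lt_of_lt_of_le (by norm_num) h2)
      simp only [List.mem_filter, List.mem_range] at hb
      exact Finset.card_pos.mpr ⟨p b, mem_nbr.mpr ((hadj _ (by omega) _ (by omega)).mpr hb.2)⟩
    · intro u hu v hv huv
      obtain ⟨a, ha, rfl⟩ := Finset.mem_image.mp hu
      obtain ⟨b, hb, rfl⟩ := Finset.mem_image.mp hv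
      rw [Finset.mem_range] at ha hb
      have hadjG : G.Adj (p a) (p b) := by simpa using hAG huv
      have hab := (hadj _ (by omega) _ (by omega)).mp hadjG
      have hba := (hadj _ (by omega) _ (by omega)).mp hadjG.symm
      refine hFA a b (adjT_iff.mpr ?_) huv
      rcases lt_trichotomy a b with h | rfl | h
      · exact Or.inl (hrF a ha b hb ⟨h, hab⟩)
      · exact absurd rfl hadjG.ne
      · exact Or.inr (hrF b hb a ha ⟨h, hba⟩)
  have hdeg : ∀ c, c < M → degIn A (p c) ≤ 3 - degT M F c := by
    intro c _
    have hsub : imageFilter p M (adjT F c) ⊆ nbr G (p c) := by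
      intro v hv
      obtain ⟨b, hb, hab, rfl⟩ := mem_imageFilter.mp hv
      exact mem_nbr.mpr (hFT c b hab).2.2
    have h1 := degIn_add_card_le hAG hsub fun w hw => by
      obtain ⟨b, hb, hab, rfl⟩ := mem_imageFilter.mp hw
      exact hFA c b hab
    rw [card_imageFilter hp] at h1
    have := hG (p c)
    unfold degT
    omega
  have hout : ∀ c < M, ∑ z ∈ nbr G (p c) \ imageFilter p M (adjT T c), degIn A z ≤
      3 * (3 - degT M T c) := by
    intro c hc
    refine (Finset.sum_le_card_nsmul _ _ 3 fun z _ => (degIn_le hAG z).trans (hG z)).trans ?_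
    have hsub : imageFilter p M (adjT T c) ⊆ nbr G (p c) := by
      intro v hv
      obtain ⟨b, hb, hab, rfl⟩ := mem_imageFilter.mp hv
      exact mem_nbr.mpr ((hadj _ hc _ hb).mpr hab)
    rw [Finset.card_sdiff_of_subset hsub, card_imageFilter hp, smul_eq_mul]
    have := hG (p c)
    unfold degT
    omega
  rw [coeffTest, Bool.and_eq_true, Bool.and_eq_true, Nat.blt_eq] at hs
  have hs' : coeffTest F.length (nearPairs T F) s = true := by
    rw [coeffTest, Bool.and_eq_true, Bool.and_eq_true, Nat.blt_eq]
    exact hs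
  have hfin := hgood.union_image (N := F.length) x (nearPairs T F) (digits s) (by
      intro q hq
      have := List.all_eq_true.mp hs.1.2 q hq
      simpa [Nat.blt_eq] using this) (fun i hi => digits_eq_zero hs.1.1 hi)
    (orientCoeff_ne_zero_of_coeffTest hs') hxinj (by
      intro i hi hiA
      rw [hA, Finset.mem_sdiff] at hiA
      exact hiA.2 (Finset.mem_image.mpr ⟨i, Finset.mem_range.mpr hi, rfl⟩)) (by
      intro i j hij hj hn
      left
      simp only [nearPairs, List.mem_flatMap, List.mem_range, List.mem_map, List.mem_filter]
      refine ⟨j, hj, i, ⟨hij, ?_⟩, rfl⟩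
      obtain ⟨-, u, hu, v, hv, huv⟩ := hn
      have h1 := hF _ (hmem i (by omega))
      have h2 := hF _ (hmem j hj)
      obtain ⟨a, ha, haM, rfl⟩ : ∃ a ∈ [(F.getD i (0, 0)).1, (F.getD i (0, 0)).2], a < M ∧
          u = p a := by
        rcases Sym2.mem_iff.mp hu with rfl | rfl
        · exact ⟨_, by simp, by omega, rfl⟩
        · exact ⟨_, by simp, by omega, rfl⟩
      obtain ⟨b, hb, hbM, rfl⟩ : ∃ b ∈ [(F.getD j (0, 0)).1, (F.getD j (0, 0)).2], b < M ∧
          v = p b := by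
        rcases Sym2.mem_iff.mp hv with rfl | rfl
        · exact ⟨_, by simp, by omega, rfl⟩
        · exact ⟨_, by simp, by omega, rfl⟩
      refine List.any_eq_true.mpr ⟨a, ha, List.any_eq_true.mpr ⟨b, hb, ?_⟩⟩
      rw [Bool.or_eq_true, Nat.beq_eq]
      exact huv.imp (hinj a haM b hbM) (hadj a haM b hbM).mp) (by
      intro i hi
      have hq := hF _ (hmem i hi)
      have hb := hbd i hi
      have hL' := hL _ (mem_edges.mp (hxG i hi))
      have hiA : x i ∉ A := by
        intro hiA
        rw [hA, Finset.mem_sdiff] at hiA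
        exact hiA.2 (Finset.mem_image.mpr ⟨i, Finset.mem_range.mpr hi, rfl⟩)
      have h1 := card_nearIn_le hAG hiA
      revert h1 hb hq
      change _ → _ → (nearIn G A (x i)).card ≤ _ → _
      generalize F.getD i (0, 0) = q
      intro hq hb h1
      have hsub : (nbr G (p q.1) ∪ nbr G (p q.2)) \ {p q.1, p q.2} ⊆
          imageFilter p M (besideT T q) ∪
            ((nbr G (p q.1) \ imageFilter p M (adjT T q.1)) ∪
              (nbr G (p q.2) \ imageFilter p M (adjT T q.2))) := by
        intro z hz
        simp only [Finset.mem_sdiff, Finset.mem_union, Finset.mem_insert, Finset.mem_singleton,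
          not_or] at hz ⊢
        by_cases hzb : z ∈ imageFilter p M (besideT T q)
        · exact Or.inl hzb
        right
        refine hz.1.imp (fun h => ⟨h, fun hc => hzb ?_⟩) fun h => ⟨h, fun hc => hzb ?_⟩ <;>
        · obtain ⟨c, hcM, hac, rfl⟩ := mem_imageFilter.mp hc
          refine mem_imageFilter.mpr ⟨c, hcM, ?_, rfl⟩
          simp only [besideT, Bool.and_eq_true, Bool.or_eq_true, Bool.not_eq_true',
            ← Bool.not_eq_true, Nat.beq_eq, hac, true_or, or_true, true_and]
          exact ⟨fun e => hz.2.1 (by rw [e]), fun e => hz.2.2 (by rw [e])⟩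
      have h2 := h1.trans (Finset.sum_le_sum_of_subset hsub)
      have hu : ∀ S S' : Finset V, ∑ z ∈ S ∪ S', degIn A z ≤
          ∑ z ∈ S, degIn A z + ∑ z ∈ S', degIn A z := by
        intro S S'
        rw [← Finset.sum_union_inter]
        omega
      have h3 := hu (imageFilter p M (besideT T q))
        ((nbr G (p q.1) \ imageFilter p M (adjT T q.1)) ∪
              (nbr G (p q.2) \ imageFilter p M (adjT T q.2)))
      have h4 := hu (nbr G (p q.1) \ imageFilter p M (adjT T q.1))
              (nbr G (p q.2) \ imageFilter p M (adjT T q.2))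
      have h5 := hout q.1 (by omega)
      have h6 := hout q.2 (by omega)
      have h7 : ∑ z ∈ imageFilter p M (besideT T q), degIn A z ≤
          (((List.range M).filter (besideT T q)).map fun c => 3 - degT M F c).sum := by
        rw [sum_imageFilter hp]
        refine List.sum_le_sum fun c hc => hdeg c ?_
        exact List.mem_range.mp (List.mem_filter.mp hc).1
      unfold boundT at hb
      omega)
  refine hfin.mono fun e he => ?_
  rw [hA]
  by_cases hex : e ∈ (Finset.range F.length).image x
  · exact Finset.mem_union_right _ hex
  · exact Finset.mem_union_left _ (Finset.mem_sdiff.mpr ⟨he, hex⟩)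

end Template

section Family

/-- The pairs below `M` which are in neither list and both of whose members have degree less than
three in `T`. -/
def missingT (M : ℕ) (T C : List (ℕ × ℕ)) : List (ℕ × ℕ) :=
  (List.range M).flatMap fun a => ((List.range M).filter fun b =>
    Nat.blt a b && !adjT T a b && !adjT C a b &&
      Nat.blt (degT M T a) 3 && Nat.blt (degT M T b) 3).map fun b => (a, b)

/-- The table `W` provides a witness of reducibility of `T ++ X` for every list `X` of members of
`C` which does not contain `B`. -/
def ReducibleFamily (M r : ℕ) (T C F B : List (ℕ × ℕ)) (W : List (List (ℕ × ℕ) × ℕ)) : Prop :=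
  0 < r ∧ (∀ X ∈ C.sublists, (B ≠ [] ∧ B ⊆ X) ∨ X ∈ W.map Prod.fst) ∧
    ∀ w ∈ W, Reducible M r (T ++ w.1) F w.2

noncomputable instance (M r : ℕ) (T C F B : List (ℕ × ℕ)) (W : List (List (ℕ × ℕ) × ℕ)) :
    Decidable (ReducibleFamily M r T C F B W) := by
  unfold ReducibleFamily
  infer_instance

theorem adjT_append {T X : List (ℕ × ℕ)} {a b : ℕ} :
    adjT (T ++ X) a b = true ↔ adjT T a b = true ∨ adjT X a b = true := by
  simp [adjT]

theorem adjT_comm (T : List (ℕ × ℕ)) (a b : ℕ) : adjT T a b = adjT T b a := by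
  rw [Bool.eq_iff_iff, adjT_iff, adjT_iff, or_comm]

open Classical

variable {V : Type*} [Fintype V] {G : SimpleGraph V} {L : Sym2 V → Finset ℕ}

theorem ReducibleFamily.colourable {M r : ℕ} {T C F B : List (ℕ × ℕ)}
    {W : List (List (ℕ × ℕ) × ℕ)} (h : ReducibleFamily M r T C F B W)
    (hG : ∀ v, (nbr G v).card ≤ 3) (hL : ∀ e ∈ G.edgeSet, 10 ≤ (L e).card)
    (hIH : ∀ R : Finset V, (∃ v ∈ R, 1 ≤ (nbr G v).card) → Colourable G L (edgesAvoiding G R))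
    {p : ℕ → V} (hp : Set.InjOn p (Set.Iio M))
    (hT : ∀ q ∈ T, G.Adj (p q.1) (p q.2))
    (hmissing : ∀ q ∈ missingT M T C, ¬ G.Adj (p q.1) (p q.2))
    (hB : B ≠ [] → ∃ q ∈ B, ¬ G.Adj (p q.1) (p q.2)) :
    Colourable G L (edges G) := by
  obtain ⟨hr0, hX, hW⟩ := h
  obtain ⟨X, hXdef⟩ : ∃ X, X = C.filter fun q => decide (G.Adj (p q.1) (p q.2)) := ⟨_, rfl⟩
  have hXmem : ∀ q, q ∈ X ↔ q ∈ C ∧ G.Adj (p q.1) (p q.2) := by simp [hXdef]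
  have hXW : X ∈ W.map Prod.fst := by
    refine (hX X ?_).resolve_left ?_
    · rw [List.mem_sublists, hXdef]
      exact List.filter_sublist
    · rintro ⟨hne, hsub⟩
      obtain ⟨q, hq, hqn⟩ := hB hne
      exact hqn ((hXmem q).mp (hsub hq)).2
  obtain ⟨w, hw, rfl⟩ := List.mem_map.mp hXW
  refine (hW w hw).colourable hG hL hIH hr0 hp ?_
  have hTadj : ∀ a b, adjT T a b = true → G.Adj (p a) (p b) := by
    intro a b hab
    rcases adjT_iff.mp hab with h | h
    · exact hT _ h
    · exact (hT _ h).symm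
  have hfull : ∀ a < M, ∀ b < M, G.Adj (p a) (p b) → 3 ≤ degT M T a → adjT T a b = true := by
    intro a ha b hb hab h3
    have hsub : imageFilter p M (adjT T a) ⊆ nbr G (p a) := by
      intro v hv
      obtain ⟨c, hc, hac, rfl⟩ := mem_imageFilter.mp hv
      exact mem_nbr.mpr (hTadj _ _ hac)
    have heq := Finset.eq_of_subset_of_card_le hsub (by
      rw [card_imageFilter hp]
      exact (hG _).trans h3)
    have hb' : p b ∈ imageFilter p M (adjT T a) := by
      rw [heq]
      exact mem_nbr.mpr hab
    obtain ⟨c, hc, hac, hcb⟩ := mem_imageFilter.mp hb'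
    rwa [← hp hc hb hcb]
  have hlt : ∀ a < M, ∀ b < M, a < b → G.Adj (p a) (p b) → adjT (T ++ w.1) a b = true := by
    intro a ha b hb hlt hab
    rw [adjT_append]
    by_contra! hcon
    refine hmissing (a, b) ?_ hab
    simp only [missingT, List.mem_flatMap, List.mem_range, List.mem_map, List.mem_filter,
      Bool.and_eq_true, Nat.blt_eq, Bool.not_eq_true', ← Bool.not_eq_true]
    refine ⟨a, ha, b, ⟨hb, ⟨⟨⟨hlt, hcon.1⟩, fun hC => hcon.2 ?_⟩, ?_⟩, ?_⟩, rfl⟩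
    · rw [adjT_iff] at hC ⊢
      exact hC.imp (fun h => (hXmem _).mpr ⟨h, hab⟩) fun h => (hXmem _).mpr ⟨h, hab.symm⟩
    · by_contra h3
      exact hcon.1 (hfull a ha b hb hab (by omega))
    · by_contra h3
      exact hcon.1 (adjT_comm T a b ▸ hfull b hb a ha hab.symm (by omega))
  intro a ha b hb
  constructor
  · intro hab
    rcases lt_trichotomy a b with h | rfl | h
    · exact hlt a ha b hb h hab
    · exact absurd rfl hab.ne
    · exact adjT_comm _ a b ▸ hlt b hb a ha h hab.symm
  · intro hab
    rcases adjT_append.mp hab with h | h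
    · exact hTadj a b h
    · rcases adjT_iff.mp h with h | h
      · exact ((hXmem _).mp h).2
      · exact ((hXmem _).mp h).2.symm

end Family

section Templates

theorem reducibleFamily_triangle : ReducibleFamily 3 3
    [(0, 1), (0, 2), (1, 2)]
    []
    [(0, 1), (0, 2), (1, 2)]
    []
    [([], 513)] := by
  decide +kernel

theorem reducibleFamily_closedK23 : ReducibleFamily 6 5
    [(0, 2), (0, 3), (0, 4), (1, 2), (1, 3), (1, 4), (2, 5), (3, 5)]
    [(4, 5)]
    [(0, 2), (0, 3), (0, 4), (1, 2), (1, 3), (1, 4), (2, 5), (3, 5)]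
    []
    [([], 271737973), ([(4, 5)], 624957238)] := by
  decide +kernel

theorem reducibleFamily_openK23 : ReducibleFamily 8 5
    [(0, 2), (0, 3), (0, 4), (1, 2), (1, 3), (1, 4), (2, 5), (3, 6), (4, 7)]
    [(5, 6), (5, 7), (6, 7)]
    [(0, 2), (0, 3), (0, 4), (1, 2), (1, 3), (1, 4), (2, 5), (3, 6), (4, 7)]
    [(5, 6), (5, 7), (6, 7)]
    [([], 9184821558), ([(6, 7)], 17234817829), ([(5, 7)], 18008339539), ([(5, 7), (6, 7)],
     9463805765), ([(5, 6)], 13495256434), ([(5, 6), (6, 7)], 18323998550), ([(5, 6), (5, 7)],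
     18023330165)] := by
  decide +kernel

theorem reducibleFamily_domino : ReducibleFamily 6 6
    [(0, 1), (1, 2), (2, 3), (0, 3), (0, 4), (1, 5), (4, 5)]
    []
    [(0, 1), (1, 2), (0, 3), (0, 4), (1, 5), (2, 3), (4, 5)]
    []
    [([], 36848405)] := by
  decide +kernel

theorem reducibleFamily_bridgedSquare : ReducibleFamily 9 6
    [(0, 1), (1, 2), (2, 3), (0, 3), (0, 4), (1, 6), (2, 5), (3, 7), (4, 5), (4, 8)]
    [(6, 7), (6, 8), (7, 8)]
    [(0, 1), (1, 2), (2, 3), (0, 3), (0, 4), (1, 6), (2, 5), (3, 7), (4, 5), (4, 8)]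
    [(6, 7), (6, 8), (7, 8)]
    [([], 82210682453), ([(7, 8)], 151215371094), ([(6, 8)], 215640859959), ([(6, 8), (7, 8)],
     86774080615), ([(6, 7)], 86809657959), ([(6, 7), (7, 8)], 154958976295), ([(6, 7), (6,
     8)], 151435621735)] := by
  decide +kernel

theorem reducibleFamily_openSquare : ReducibleFamily 8 4
    [(0, 1), (1, 2), (2, 3), (0, 3), (0, 4), (1, 5), (2, 6), (3, 7)]
    []
    [(0, 1), (1, 2), (2, 3), (0, 3), (0, 4), (1, 5), (2, 6), (3, 7)]
    []
    [([], 859001396)] := by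
  decide +kernel

theorem reducibleFamily_pentagon : ReducibleFamily 10 5
    [(0, 5), (0, 1), (1, 6), (1, 2), (2, 7), (2, 3), (3, 8), (3, 4), (4, 9), (0, 4)]
    [(5, 7), (6, 8), (7, 9), (5, 8), (6, 9)]
    [(0, 5), (0, 1), (1, 6), (1, 2), (2, 7), (2, 3), (3, 8), (3, 4), (4, 9), (0, 4)]
    []
    [([], 357863478080), ([(6, 9)], 357863478336), ([(5, 8)], 357880255296), ([(5, 8), (6, 9)],
     293455746112), ([(7, 9)], 362141733696), ([(7, 9), (6, 9)], 366418875472), ([(7, 9), (5,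
     8)], 362158510912), ([(7, 9), (5, 8), (6, 9)], 366435652688), ([(6, 8)], 353585288256),
     ([(6, 8), (6, 9)], 293455746352), ([(6, 8), (5, 8)], 353602065472), ([(6, 8), (5, 8), (6,
     9)], 353602065728), ([(6, 8), (7, 9)], 361638417472), ([(6, 8), (7, 9), (6, 9)],
     366485984528), ([(6, 8), (7, 9), (5, 8)], 361655194688), ([(6, 8), (7, 9), (5, 8), (6, 9)],
     366487033104), ([(5, 7)], 357863543616), ([(5, 7), (6, 9)], 357863543872), ([(5, 7), (5,
     8)], 353601082192), ([(5, 7), (5, 8), (6, 9)], 293455811648), ([(5, 7), (7, 9)],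
     362141799232), ([(5, 7), (7, 9), (6, 9)], 366418941008), ([(5, 7), (7, 9), (5, 8)],
     361906918208), ([(5, 7), (7, 9), (5, 8), (6, 9)], 366436766784), ([(5, 7), (6, 8)],
     357894997072), ([(5, 7), (6, 8), (6, 9)], 293455811888), ([(5, 7), (6, 8), (5, 8)],
     353602131008), ([(5, 7), (6, 8), (5, 8), (6, 9)], 362206741584), ([(5, 7), (6, 8), (7, 9)],
     361638483008), ([(5, 7), (6, 8), (7, 9), (6, 9)], 366418941264), ([(5, 7), (6, 8), (7, 9),
     (5, 8)], 361906918464), ([(5, 7), (6, 8), (7, 9), (5, 8), (6, 9)], 224753177920)] := by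
  decide +kernel

theorem reducibleFamily_hexagon : ReducibleFamily 12 6
    [(0, 6), (0, 1), (1, 7), (1, 2), (2, 8), (2, 3), (3, 9), (3, 4), (4, 10), (4, 5), (5, 11),
     (0, 5)]
    [(6, 9), (7, 10), (8, 11)]
    [(0, 6), (0, 1), (1, 7), (1, 2), (2, 8), (2, 3), (3, 9), (3, 4), (4, 10), (4, 5), (5, 11),
     (0, 5)]
    []
    [([], 73956438790992), ([(8, 11)], 92643574174528), ([(7, 10)], 91483932939328), ([(7, 10),
     (8, 11)], 92643574174784), ([(6, 9)], 73956455568208), ([(6, 9), (8, 11)], 90517582140224),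
     ([(6, 9), (7, 10)], 56437016581184), ([(6, 9), (7, 10), (8, 11)], 92643590952000)] := by
  decide +kernel

end Templates

section Minimal

open Classical

variable {V : Type*} [Fintype V] {G : SimpleGraph V} {L : Sym2 V → Finset ℕ}

/-- A subcubic graph with lists of ten colours which cannot be coloured, while every graph obtained
by removing all edges at a set of vertices can. -/
structure MinimalCounterexample (G : SimpleGraph V) (L : Sym2 V → Finset ℕ) : Prop where
  subcubic : ∀ v, (nbr G v).card ≤ 3
  lists : ∀ e ∈ G.edgeSet, 10 ≤ (L e).card
  avoiding : ∀ R : Finset V, (∃ v ∈ R, 1 ≤ (nbr G v).card) → Colourable G L (edgesAvoiding G R)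
  not_colourable : ¬ Colourable G L (edges G)

namespace MinimalCounterexample

theorem not_family (H : MinimalCounterexample G L) {M r : ℕ} {T C F B : List (ℕ × ℕ)}
    {W : List (List (ℕ × ℕ) × ℕ)} (h : ReducibleFamily M r T C F B W) {l : List V} (d : V)
    (hl : l.Nodup) (hM : M ≤ l.length) (hT : ∀ q ∈ T, G.Adj (l.getD q.1 d) (l.getD q.2 d))
    (hmissing : ∀ q ∈ missingT M T C, ¬ G.Adj (l.getD q.1 d) (l.getD q.2 d))
    (hB : B ≠ [] → ∃ q ∈ B, ¬ G.Adj (l.getD q.1 d) (l.getD q.2 d)) : False := by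
  refine H.not_colourable (h.colourable H.subcubic H.lists H.avoiding
    (p := fun k => l.getD k d) ?_ hT hmissing hB)
  intro i hi j hj hij
  have hi' : i < l.length := lt_of_lt_of_le hi hM
  have hj' : j < l.length := lt_of_lt_of_le hj hM
  simp only [List.getD_eq_getElem _ _ hi', List.getD_eq_getElem _ _ hj'] at hij
  exact hl.getElem_inj_iff.mp hij

theorem card_nbr (H : MinimalCounterexample G L) {u v : V} (h : G.Adj u v) :
    (nbr G u).card = 3 := by
  refine le_antisymm (H.subcubic u) ?_
  by_contra! hlt
  exact H.not_colourable (Colourable.of_card_nbr_le_two H.subcubic H.lists (by omega)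
    (H.avoiding {u} ⟨u, by simp, Finset.card_pos.mpr ⟨v, mem_nbr.mpr h⟩⟩))

theorem exists_third (H : MinimalCounterexample G L) {u v w : V} (hv : G.Adj u v) (hw : G.Adj u w)
    (hvw : v ≠ w) : ∃ x, G.Adj u x ∧ x ≠ v ∧ x ≠ w ∧ ∀ y, G.Adj u y → y = v ∨ y = w ∨ y = x := by
  have hsub : ({v, w} : Finset V) ⊆ nbr G u := by
    intro y hy
    simp only [Finset.mem_insert, Finset.mem_singleton] at hy
    rcases hy with rfl | rfl
    · exact mem_nbr.mpr hv
    · exact mem_nbr.mpr hw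
  have h1 : (nbr G u \ {v, w}).card = 1 := by
    rw [Finset.card_sdiff_of_subset hsub, H.card_nbr hv, Finset.card_pair hvw]
  obtain ⟨x, hx⟩ := Finset.card_eq_one.mp h1
  have hx' : ∀ y, (G.Adj u y ∧ ¬ (y = v ∨ y = w)) ↔ y = x := by
    intro y
    have := Finset.ext_iff.mp hx y
    simpa [mem_nbr] using this
  have hxx := (hx' x).mpr rfl
  refine ⟨x, hxx.1, fun h => hxx.2 (Or.inl h), fun h => hxx.2 (Or.inr h), fun y hy => ?_⟩
  by_cases h : y = v ∨ y = w
  · tauto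
  · exact Or.inr (Or.inr ((hx' y).mp ⟨hy, h⟩))

theorem no_triangle (H : MinimalCounterexample G L) {a b c : V} (hab : G.Adj a b)
    (hac : G.Adj a c) (hbc : G.Adj b c) : False := by
  refine H.not_family reducibleFamily_triangle (l := [a, b, c]) a ?_ le_rfl ?_ ?_ (by simp)
  · simp [hab.ne, hac.ne, hbc.ne]
  · simp [hab, hac, hbc]
  · have : missingT 3 [(0, 1), (0, 2), (1, 2)] [] = [] := by decide
    simp [this]

theorem no_closedK23 (H : MinimalCounterexample G L) {x y a b c q : V} (hxy : x ≠ y)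
    (hxa : G.Adj x a) (hxb : G.Adj x b) (hxc : G.Adj x c) (hya : G.Adj y a) (hyb : G.Adj y b)
    (hyc : G.Adj y c) (hab : a ≠ b) (hac : a ≠ c) (hbc : b ≠ c) (hqx : q ≠ x) (hqy : q ≠ y)
    (haq : G.Adj a q) (hbq : G.Adj b q) : False := by
  have hqc : q ≠ c := by
    rintro rfl
    exact H.no_triangle hxa hxc haq
  refine H.not_family reducibleFamily_closedK23 (l := [x, y, a, b, c, q]) x ?_ le_rfl ?_ ?_
    (by simp)
  · simp [hxy, hxa.ne, hxb.ne, hxc.ne, hya.ne, hyb.ne, hyc.ne, hab, hac, hbc, hqx.symm, hqy.symm,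
      haq.ne, hbq.ne, hqc.symm]
  · simp [hxa, hxb, hxc, hya, hyb, hyc, haq, hbq]
  · have : missingT 6 [(0, 2), (0, 3), (0, 4), (1, 2), (1, 3), (1, 4), (2, 5), (3, 5)] [(4, 5)] =
        [] := by decide
    simp [this]

theorem no_K23 (H : MinimalCounterexample G L) {x y a b c : V} (hxy : x ≠ y)
    (hxa : G.Adj x a) (hxb : G.Adj x b) (hxc : G.Adj x c) (hya : G.Adj y a) (hyb : G.Adj y b)
    (hyc : G.Adj y c) (hab : a ≠ b) (hac : a ≠ c) (hbc : b ≠ c) : False := by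
  obtain ⟨a', haa, hax, hay, -⟩ := H.exists_third hxa.symm hya.symm hxy
  obtain ⟨b', hbb, hbx, hby, -⟩ := H.exists_third hxb.symm hyb.symm hxy
  obtain ⟨c', hcc, hcx, hcy, -⟩ := H.exists_third hxc.symm hyc.symm hxy
  have hn : ∀ {u v}, G.Adj x u → G.Adj x v → ¬ G.Adj u v := fun hu hv huv => H.no_triangle hu hv huv
  have hab' : a' ≠ b' := by
    rintro rfl
    exact H.no_closedK23 hxy hxa hxb hxc hya hyb hyc hab hac hbc hax hay haa hbb
  have hac' : a' ≠ c' := by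
    rintro rfl
    exact H.no_closedK23 hxy hxa hxc hxb hya hyc hyb hac hab hbc.symm hax hay haa hcc
  have hbc' : b' ≠ c' := by
    rintro rfl
    exact H.no_closedK23 hxy hxb hxc hxa hyb hyc hya hbc hab.symm hac.symm hbx hby hbb hcc
  have hne : ∀ {u v u'}, G.Adj x u → G.Adj x v → G.Adj u u' → v ≠ u' := by
    rintro u v _ hu hv huu rfl
    exact hn hu hv huu
  refine H.not_family reducibleFamily_openK23 (l := [x, y, a, b, c, a', b', c']) x ?_ le_rfl ?_ ?_
    fun _ => ?_
  · simp [hxy, hxa.ne, hxb.ne, hxc.ne, hya.ne, hyb.ne, hyc.ne, hab, hac, hbc, hab', hac', hbc',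
      hax.symm, hay.symm, hbx.symm, hby.symm, hcx.symm, hcy.symm, haa.ne, hbb.ne, hcc.ne,
      hne hxa hxb haa, hne hxa hxc haa, hne hxb hxa hbb, hne hxb hxc hbb, hne hxc hxa hcc,
      hne hxc hxb hcc]
  · simp [hxa, hxb, hxc, hya, hyb, hyc, haa, hbb, hcc]
  · have : missingT 8 [(0, 2), (0, 3), (0, 4), (1, 2), (1, 3), (1, 4), (2, 5), (3, 6), (4, 7)]
        [(5, 6), (5, 7), (6, 7)] = [] := by decide
    simp [this]
  · by_contra! hcon
    simp only [List.forall_mem_cons] at hcon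
    exact H.no_triangle hcon.1 hcon.2.1 hcon.2.2.1

theorem no_domino (H : MinimalCounterexample G L) {v₀ v₁ v₂ v₃ w₀ w₁ : V} (h01 : G.Adj v₀ v₁)
    (h12 : G.Adj v₁ v₂) (h23 : G.Adj v₂ v₃) (h03 : G.Adj v₀ v₃) (h04 : G.Adj v₀ w₀)
    (h15 : G.Adj v₁ w₁) (h45 : G.Adj w₀ w₁) (hw₀ : w₀ ≠ v₁ ∧ w₀ ≠ v₃) (hw₁ : w₁ ≠ v₀ ∧ w₁ ≠ v₂)
    (h02 : v₀ ≠ v₂) (h13 : v₁ ≠ v₃) : False := by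
  have hw₀' : w₀ ≠ v₂ := by
    rintro rfl
    exact H.no_triangle h04 h01 h12.symm
  have hw₁' : w₁ ≠ v₃ := by
    rintro rfl
    exact H.no_triangle h01 h03 h15
  refine H.not_family reducibleFamily_domino (l := [v₀, v₁, v₂, v₃, w₀, w₁]) v₀ ?_ le_rfl ?_ ?_
    (by simp)
  · simp [h01.ne, h02, h03.ne, h04.ne, h12.ne, h13, h15.ne, h23.ne, h45.ne, hw₀.1.symm, hw₀.2.symm,
      hw₁.1.symm, hw₁.2.symm, hw₀'.symm, hw₁'.symm]
  · simp [h01, h12, h23, h03, h04, h15, h45]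
  · have : missingT 6 [(0, 1), (1, 2), (2, 3), (0, 3), (0, 4), (1, 5), (4, 5)] [] =
        [(2, 4), (2, 5), (3, 4), (3, 5)] := by decide
    simp only [this, List.forall_mem_cons, List.not_mem_nil, false_imp_iff, implies_true, and_true]
    refine ⟨fun h => ?_, fun h => ?_, fun h => ?_, fun h => ?_⟩
    · exact H.no_K23 h02 h01 h03 h04 h12.symm h23 h h13 hw₀.1.symm hw₀.2.symm
    · exact H.no_triangle h12 h15 h
    · exact H.no_triangle h03 h04 h
    · exact H.no_K23 h13 h01.symm h12 h15 h03.symm h23.symm h h02 hw₁.1.symm hw₁.2.symm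

theorem no_bridgedSquare (H : MinimalCounterexample G L) {v₀ v₁ v₂ v₃ w₀ w₂ : V}
    (h01 : G.Adj v₀ v₁) (h12 : G.Adj v₁ v₂) (h23 : G.Adj v₂ v₃) (h03 : G.Adj v₀ v₃)
    (hvw₀ : G.Adj v₀ w₀) (hvw₂ : G.Adj v₂ w₂) (hww : G.Adj w₀ w₂) (hw₀ : w₀ ≠ v₁ ∧ w₀ ≠ v₃)
    (hw₂ : w₂ ≠ v₁ ∧ w₂ ≠ v₃) (h02 : v₀ ≠ v₂) (h13 : v₁ ≠ v₃) : False := by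
  obtain ⟨w₁, hvw₁, h10, h12', -⟩ := H.exists_third h01.symm h12 h02
  obtain ⟨w₃, hvw₃, h30, h32, -⟩ := H.exists_third h03.symm h23.symm h02
  have e02 : v₀ ≠ w₂ := by
    rintro rfl
    exact H.no_triangle h01 hvw₂.symm h12
  have e20 : v₂ ≠ w₀ := by
    rintro rfl
    exact H.no_triangle h01 hvw₀ h12
  obtain ⟨x, hwx, hx0, hx2, -⟩ := H.exists_third hvw₀.symm hww e02
  have e13 : v₁ ≠ w₃ := by
    rintro rfl
    exact H.no_triangle h01 h03 hvw₃.symm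
  have e31 : v₃ ≠ w₁ := by
    rintro rfl
    exact H.no_triangle h01 h03 hvw₁
  have e1x : v₁ ≠ x := by
    rintro rfl
    exact H.no_triangle h01 hvw₀ hwx.symm
  have e2x : v₂ ≠ x := by
    rintro rfl
    exact H.no_triangle hww hwx hvw₂.symm
  have e3x : v₃ ≠ x := by
    rintro rfl
    exact H.no_triangle h03 hvw₀ hwx.symm
  have f01 : w₀ ≠ w₁ := by
    rintro rfl
    exact H.no_triangle h01 hvw₀ hvw₁
  have f03 : w₀ ≠ w₃ := by
    rintro rfl
    exact H.no_triangle h03 hvw₀ hvw₃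
  have f21 : w₂ ≠ w₁ := by
    rintro rfl
    exact H.no_triangle h12 hvw₁ hvw₂
  have f23 : w₂ ≠ w₃ := by
    rintro rfl
    exact H.no_triangle h23 hvw₂ hvw₃
  have f13 : w₁ ≠ w₃ := by
    rintro rfl
    exact H.no_K23 h13 h01.symm h12 hvw₁ h03.symm h23.symm hvw₃ h02 h10.symm h12'.symm
  have f1x : w₁ ≠ x := by
    rintro rfl
    exact H.no_domino h01 h12 h23 h03 hvw₀ hvw₁ hwx hw₀ ⟨h10, h12'⟩ h02 h13
  have f3x : w₃ ≠ x := by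
    rintro rfl
    exact H.no_domino h03 h23.symm h12.symm h01 hvw₀ hvw₃ hwx hw₀.symm ⟨h30, h32⟩ h02 h13.symm
  refine H.not_family reducibleFamily_bridgedSquare (l := [v₀, v₁, v₂, v₃, w₀, w₂, w₁, w₃, x]) v₀
    ?_ le_rfl ?_ ?_ fun _ => ?_
  · simp [h01.ne, h02, h03.ne, hvw₀.ne, e02, h10.symm, h30.symm, hx0.symm, h12.ne, h13,
      hw₀.1.symm, hw₂.1.symm, hvw₁.ne, e13, e1x, h23.ne, e20, hvw₂.ne, h12'.symm, h32.symm, e2x,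
      hw₀.2.symm, hw₂.2.symm, e31, hvw₃.ne, e3x, hww.ne, f01, f03, hwx.ne, f21, f23, hx2.symm,
      f13, f1x, f3x]
  · simp [h01, h12, h23, h03, hvw₀, hvw₁, hvw₂, hvw₃, hww, hwx]
  · have : missingT 9 [(0, 1), (1, 2), (2, 3), (0, 3), (0, 4), (1, 6), (2, 5), (3, 7), (4, 5),
        (4, 8)] [(6, 7), (6, 8), (7, 8)] = [(5, 6), (5, 7), (5, 8)] := by decide
    simp only [this, List.forall_mem_cons, List.not_mem_nil, false_imp_iff, implies_true, and_true]
    refine ⟨fun h => ?_, fun h => ?_, fun h => ?_⟩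
    · exact H.no_domino h12.symm h01.symm h03 h23 hvw₂ hvw₁ h hw₂ ⟨h12', h10⟩ h02.symm h13
    · exact H.no_domino h23 h03.symm h01 h12.symm hvw₂ hvw₃ h hw₂.symm ⟨h32, h30⟩ h02.symm h13.symm
    · exact H.no_triangle hww hwx h
  · by_contra! hcon
    simp only [List.forall_mem_cons] at hcon
    exact H.no_triangle hcon.1 hcon.2.1 hcon.2.2.1

theorem no_square (H : MinimalCounterexample G L) {v₀ v₁ v₂ v₃ : V}
    (h01 : G.Adj v₀ v₁) (h12 : G.Adj v₁ v₂) (h23 : G.Adj v₂ v₃) (h03 : G.Adj v₀ v₃)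
    (h02 : v₀ ≠ v₂) (h13 : v₁ ≠ v₃) : False := by
  obtain ⟨w₀, h0, a0, b0, -⟩ := H.exists_third h01 h03 h13
  obtain ⟨w₁, h1, a1, b1, -⟩ := H.exists_third h01.symm h12 h02
  obtain ⟨w₂, h2, a2, b2, -⟩ := H.exists_third h12.symm h23 h13
  obtain ⟨w₃, h3, a3, b3, -⟩ := H.exists_third h03.symm h23.symm h02
  have e02 : v₀ ≠ w₂ := by
    rintro rfl
    exact H.no_triangle h01 h2.symm h12
  have e20 : v₂ ≠ w₀ := by
    rintro rfl
    exact H.no_triangle h01 h0 h12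
  have e13 : v₁ ≠ w₃ := by
    rintro rfl
    exact H.no_triangle h01 h03 h3.symm
  have e31 : v₃ ≠ w₁ := by
    rintro rfl
    exact H.no_triangle h01 h03 h1
  have f01 : w₀ ≠ w₁ := by
    rintro rfl
    exact H.no_triangle h01 h0 h1
  have f03 : w₀ ≠ w₃ := by
    rintro rfl
    exact H.no_triangle h03 h0 h3
  have f12 : w₁ ≠ w₂ := by
    rintro rfl
    exact H.no_triangle h12 h1 h2
  have f23 : w₂ ≠ w₃ := by
    rintro rfl
    exact H.no_triangle h23 h2 h3
  have f02 : w₀ ≠ w₂ := by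
    rintro rfl
    exact H.no_K23 h02 h01 h03 h0 h12.symm h23 h2 h13 a0.symm b0.symm
  have f13 : w₁ ≠ w₃ := by
    rintro rfl
    exact H.no_K23 h13 h01.symm h12 h1 h03.symm h23.symm h3 h02 a1.symm b1.symm
  refine H.not_family reducibleFamily_openSquare (l := [v₀, v₁, v₂, v₃, w₀, w₁, w₂, w₃]) v₀
    ?_ le_rfl ?_ ?_ (by simp)
  · simp [h01.ne, h02, h03.ne, h12.ne, h13, h23.ne, h0.ne, h1.ne, h2.ne, h3.ne, a0.symm, b0.symm,
      a1.symm, b1.symm, a2.symm, b2.symm, a3.symm, b3.symm, e02, e20, e13, e31, f01, f02, f03, f12,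
      f13, f23]
  · simp [h01, h12, h23, h03, h0, h1, h2, h3]
  · have : missingT 8 [(0, 1), (1, 2), (2, 3), (0, 3), (0, 4), (1, 5), (2, 6), (3, 7)] [] =
        [(4, 5), (4, 6), (4, 7), (5, 6), (5, 7), (6, 7)] := by decide
    simp only [this, List.forall_mem_cons, List.not_mem_nil, false_imp_iff, implies_true, and_true]
    refine ⟨fun h => ?_, fun h => ?_, fun h => ?_, fun h => ?_, fun h => ?_, fun h => ?_⟩
    · exact H.no_domino h01 h12 h23 h03 h0 h1 h ⟨a0, b0⟩ ⟨a1, b1⟩ h02 h13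
    · exact H.no_bridgedSquare h01 h12 h23 h03 h0 h2 h ⟨a0, b0⟩ ⟨a2, b2⟩ h02 h13
    · exact H.no_domino h03 h23.symm h12.symm h01 h0 h3 h ⟨b0, a0⟩ ⟨a3, b3⟩ h02 h13.symm
    · exact H.no_domino h12 h23 h03.symm h01.symm h1 h2 h ⟨b1, a1⟩ ⟨a2, b2⟩ h13 h02.symm
    · exact H.no_bridgedSquare h12 h23 h03.symm h01.symm h1 h3 h ⟨b1, a1⟩ ⟨b3, a3⟩ h13 h02.symm
    · exact H.no_domino h23 h03.symm h01 h12.symm h2 h3 h ⟨b2, a2⟩ ⟨b3, a3⟩ h02.symm h13.symm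

end MinimalCounterexample

end Minimal

section Cycles

open Classical

variable {V : Type*} {G : SimpleGraph V}

/-- `v` winds around a cycle of length `n`. -/
structure IsCycleMap (G : SimpleGraph V) (n : ℕ) (v : ℤ → V) : Prop where
  three_le : 3 ≤ n
  adj : ∀ i, G.Adj (v i) (v (i + 1))
  eq_iff : ∀ i j, v i = v j ↔ (n : ℤ) ∣ j - i

/-- `v` winds around a shortest cycle, which has length `n`. -/
structure IsShortestCycleMap (G : SimpleGraph V) (n : ℕ) (v : ℤ → V) : Prop
    extends IsCycleMap G n v where
  le : ∀ m u, IsCycleMap G m u → n ≤ m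

theorem exists_isCycleMap_of_path {u : ℕ → V} {n : ℕ} (hn : 3 ≤ n) (hu : Set.InjOn u (Set.Iio n))
    (hadj : ∀ j, j + 1 < n → G.Adj (u j) (u (j + 1))) (hlast : G.Adj (u (n - 1)) (u 0)) :
    ∃ v, IsCycleMap G n v := by
  have hpos : (0 : ℤ) < n := by omega
  refine ⟨fun i => u (i % n).toNat, hn, fun i => ?_, fun i j => ?_⟩
  · have h0 := Int.emod_nonneg i hpos.ne'
    have h1 := Int.emod_lt_of_pos i hpos
    by_cases h : i % n = n - 1
    · have h' : (i + 1) % n = 0 := by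
        rw [Int.add_emod, h, Int.emod_eq_of_lt (a := 1) (by omega) (by omega)]
        simp
      have e1 : ((n : ℤ) - 1).toNat = n - 1 := by omega
      simpa [h, h', e1] using hlast
    · have h' : (i + 1) % n = i % n + 1 := by
        rw [Int.add_emod, Int.emod_eq_of_lt (a := 1) (by omega) (by omega),
          Int.emod_eq_of_lt (by omega) (by omega)]
      have e1 : (i % n + 1).toNat = (i % n).toNat + 1 := by omega
      simp only [h', e1]
      exact hadj _ (by omega)
  · have h0 := Int.emod_nonneg i hpos.ne'
    have h1 := Int.emod_lt_of_pos i hpos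
    have h2 := Int.emod_nonneg j hpos.ne'
    have h3 := Int.emod_lt_of_pos j hpos
    rw [← Int.modEq_iff_dvd, Int.ModEq]
    constructor
    · intro h
      have := hu (x₁ := (i % n).toNat) (x₂ := (j % n).toNat) (by simp; omega) (by simp; omega) h
      omega
    · intro h
      simp only [h]

theorem exists_isCycleMap [Finite V] (f : V → V → V)
    (hf : ∀ a b, G.Adj a b → G.Adj b (f a b) ∧ f a b ≠ a) {a b : V} (hab : G.Adj a b) :
    ∃ n v, IsCycleMap G n v := by
  let F : ℕ → V × V := fun k => (fun p : V × V => (p.2, f p.1 p.2))^[k] (a, b)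
  have hF : ∀ k, F (k + 1) = ((F k).2, f (F k).1 (F k).2) := fun k =>
    Function.iterate_succ_apply' _ _ _
  have hadjF : ∀ k, G.Adj (F k).1 (F k).2 := by
    intro k
    induction k with
    | zero => exact hab
    | succ k ih =>
      rw [hF]
      exact (hf _ _ ih).1
  let u : ℕ → V := fun k => (F k).1
  have hu1 : ∀ k, u (k + 1) = (F k).2 := fun k => by simp only [u, hF]
  have hadj : ∀ k, G.Adj (u k) (u (k + 1)) := fun k => by
    rw [hu1]
    exact hadjF k
  have hne : ∀ k, u (k + 2) ≠ u k := fun k => by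
    rw [hu1, hF]
    exact (hf _ _ (hadjF k)).2
  have hex : ∃ m, 0 < m ∧ ∃ i, u (i + m) = u i := by
    obtain ⟨i, j, hij, h⟩ := Finite.exists_ne_map_eq_of_infinite u
    rcases Nat.lt_or_gt_of_ne hij with hlt | hlt
    · exact ⟨j - i, by omega, i, by rw [h]; congr 1; omega⟩
    · exact ⟨i - j, by omega, j, by rw [← h]; congr 1; omega⟩
  obtain ⟨hm0, i, hi⟩ := Nat.find_spec hex
  have hmin := fun k (hk : k < Nat.find hex) => Nat.find_min hex hk
  generalize Nat.find hex = m at *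
  have hm1 : m ≠ 1 := by
    rintro rfl
    exact (hadj i).ne hi.symm
  have hm2 : m ≠ 2 := by
    rintro rfl
    exact hne i hi
  refine ⟨m, exists_isCycleMap_of_path (u := fun k => u (i + k)) (by omega) ?_
    (fun j _ => hadj _) ?_⟩
  · intro j hj k hk hjk
    simp only [Set.mem_Iio] at hj hk hjk
    by_contra hne
    rcases Nat.lt_or_gt_of_ne hne with hlt | hlt
    · exact hmin (k - j) (by omega) ⟨by omega, i + j, by rw [hjk]; congr 1; omega⟩
    · exact hmin (j - k) (by omega) ⟨by omega, i + k, by rw [← hjk]; congr 1; omega⟩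
  · have := hadj (i + (m - 1))
    rw [show i + (m - 1) + 1 = i + m by omega, hi] at this
    simpa using this

theorem exists_isShortestCycleMap (h : ∃ n v, IsCycleMap G n v) :
    ∃ n v, IsShortestCycleMap G n v := by
  obtain ⟨v, hv⟩ := Nat.find_spec h
  exact ⟨_, v, hv, fun m u hu => Nat.find_min' h ⟨u, hu⟩⟩

theorem IsCycleMap.exists_eq_add {n : ℕ} {v : ℤ → V} (hv : IsCycleMap G n v) (i j : ℤ) :
    ∃ d : ℕ, d < n ∧ (n : ℤ) ∣ j - i - d ∧ v j = v (i + d) := by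
  have := hv.three_le
  have hpos : (0 : ℤ) < n := by omega
  have h0 := Int.emod_nonneg (j - i) hpos.ne'
  have h1 := Int.emod_lt_of_pos (j - i) hpos
  have h2 : (n : ℤ) ∣ j - i - (j - i) % n := Int.dvd_self_sub_emod
  refine ⟨((j - i) % n).toNat, by omega, ?_, (hv.eq_iff _ _).mpr ?_⟩
  · rwa [Int.toNat_of_nonneg h0]
  · rw [Int.toNat_of_nonneg h0]
    have := (Int.dvd_neg (a := (n : ℤ))).mpr h2
    convert this using 1
    ring

namespace IsShortestCycleMap

variable {n : ℕ} {v : ℤ → V}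

/-- A path of length `k + 1` outside the cycle is no shortcut. -/
theorem le_add (hv : IsShortestCycleMap G n v) {i : ℤ} {d k : ℕ} (hd : d < n) (hdk : 2 ≤ d + k)
    (q : ℕ → V) (hq0 : ∀ j, j ≤ d → q j = v (i + j)) (hq : ∀ j, d < j → j ≤ d + k → ∀ t, q j ≠ v t)
    (hinj : ∀ j l, d < j → j < l → l ≤ d + k → q j ≠ q l)
    (hadj : ∀ j, d ≤ j → j < d + k → G.Adj (q j) (q (j + 1)))
    (hlast : G.Adj (q (d + k)) (v i)) : n ≤ d + k + 1 := by
  have key : ∀ j l, j < l → l < d + k + 1 → q j ≠ q l := by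
    intro j l hjl hl h
    by_cases hld : l ≤ d
    · rw [hq0 j (by omega), hq0 l hld, hv.eq_iff] at h
      have := Int.le_of_dvd (by omega) h
      omega
    · by_cases hjd : j ≤ d
      · rw [hq0 j hjd] at h
        exact hq l (by omega) (by omega) _ h.symm
      · exact hinj j l (by omega) hjl (by omega) h
  obtain ⟨u, hu⟩ := exists_isCycleMap_of_path (G := G) (u := q) (n := d + k + 1) (by omega)
    (by
      intro j hj l hl h
      by_contra hne
      rcases Nat.lt_or_gt_of_ne hne with hlt | hlt
      · exact key j l hlt hl h
      · exact key l j hlt hj h.symm)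
    (by
      intro j hj
      by_cases hjd : j < d
      · rw [hq0 j hjd.le, hq0 (j + 1) hjd]
        push_cast
        rw [← add_assoc]
        exact hv.adj _
      · exact hadj j (by omega) (by omega))
    (by
      rw [hq0 0 (by omega)]
      simpa using hlast)
  exact hv.le _ _ hu

theorem dvd_of_adj (hv : IsShortestCycleMap G n v) {i j : ℤ} (h : G.Adj (v i) (v j)) :
    (n : ℤ) ∣ j - i - 1 ∨ (n : ℤ) ∣ j - i + 1 := by
  obtain ⟨d, hd, hdvd, hvd⟩ := hv.exists_eq_add i j
  have h0 : d ≠ 0 := by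
    rintro rfl
    simp only [Nat.cast_zero, add_zero] at hvd
    exact h.ne hvd.symm
  by_cases h1 : d = 1
  · left
    subst h1
    simpa using hdvd
  · have := hv.le_add (i := i) (d := d) (k := 0) hd (by omega) (fun t => v (i + t))
      (fun _ _ => rfl) (by omega) (by omega) (by omega) (by
        rw [hvd] at h
        simpa using h.symm)
    right
    have hdn : (d : ℤ) = n - 1 := by omega
    rw [hdn] at hdvd
    rw [show j - i + 1 = j - i - (n - 1) + n by ring]
    exact dvd_add hdvd (dvd_refl _)

theorem le_of_common (hv : IsShortestCycleMap G n v) {i j : ℤ} {x : V} {d : ℕ}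
    (hdvd : (n : ℤ) ∣ j - i - d) (hd0 : 1 ≤ d) (hd : d < n) (hx : ∀ t, x ≠ v t)
    (hi : G.Adj (v i) x) (hj : G.Adj (v j) x) : n ≤ d + 2 := by
  have hvd : v (i + d) = v j := (hv.eq_iff _ _).mpr (by convert hdvd using 1; ring)
  refine hv.le_add (i := i) (d := d) (k := 1) hd (by omega)
    (fun t => if t ≤ d then v (i + t) else x) (fun _ h => by simp [h])
    (fun _ h _ => by simpa [h.not_ge] using hx) (by omega) ?_ ?_
  · intro t h1 h2
    obtain rfl : t = d := by omega
    simpa [hvd] using hj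
  · simpa using hi.symm

theorem le_of_link (hv : IsShortestCycleMap G n v) {i j : ℤ} {x y : V} {d : ℕ}
    (hdvd : (n : ℤ) ∣ j - i - d) (hd : d < n) (hd0 : 1 ≤ d) (hx : ∀ t, x ≠ v t)
    (hy : ∀ t, y ≠ v t) (hi : G.Adj (v i) x) (hj : G.Adj (v j) y) (hxy : G.Adj x y) :
    n ≤ d + 3 := by
  have hvd : v (i + d) = v j := (hv.eq_iff _ _).mpr (by convert hdvd using 1; ring)
  refine hv.le_add (i := i) (d := d) (k := 2) hd (by omega)
    (fun t => if t ≤ d then v (i + t) else if t = d + 1 then y else x) (fun _ h => by simp [h])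
    (fun t h _ => ?_) (fun t l h1 h2 h3 => ?_) (fun t h1 h2 => ?_) ?_
  · by_cases h' : t = d + 1
    · subst h'
      simpa using hy
    · simpa [h.not_ge, h'] using hx
  · obtain rfl : t = d + 1 := by omega
    obtain rfl : l = d + 2 := by omega
    simpa using hxy.ne'
  · rcases (by omega : t = d ∨ t = d + 1) with rfl | rfl
    · simpa [hvd] using hj
    · simpa using hxy.symm
  · simpa using hi.symm

end IsShortestCycleMap

end Cycles

section Pendants

open Classical

/-- `w i` is the neighbour of `v i` outside the shortest cycle `v`. -/
structure IsPendantMap {V : Type*} (G : SimpleGraph V) (n : ℕ) (v w : ℤ → V) : Prop where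
  adj : ∀ i, G.Adj (v i) (w i)
  eq_or : ∀ i y, G.Adj (v i) y → y = v (i - 1) ∨ y = v (i + 1) ∨ y = w i
  ne : ∀ i j, w i ≠ v j
  eq_iff : ∀ i j, w i = w j ↔ (n : ℤ) ∣ j - i
  le_of_adj : ∀ (i j : ℤ) (d : ℕ), (n : ℤ) ∣ j - i - d → d < n → G.Adj (w i) (w j) → n ≤ d + 3

variable {V : Type*} {G : SimpleGraph V} {n : ℕ} {v w : ℤ → V}

theorem IsPendantMap.le_six (h : IsPendantMap G n v w) (hv : IsShortestCycleMap G n v) {i j : ℤ}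
    (hij : G.Adj (w i) (w j)) : n ≤ 6 := by
  obtain ⟨d, hd, hdvd, -⟩ := hv.exists_eq_add i j
  have h1 := h.le_of_adj i j d hdvd hd hij
  by_cases h0 : d = 0
  · omega
  have h2 := h.le_of_adj j i (n - d) (by
    rw [← Int.dvd_neg, Nat.cast_sub hd.le, show -(i - j - ((n : ℤ) - d)) = j - i - d + n by ring]
    exact dvd_add hdvd (dvd_refl _)) (by omega) hij.symm
  omega

/-- The vertices `v 0, …, v (n - 1), w 0, …, w (n - 1)`. -/
def sunVertex (n : ℕ) (v w : ℤ → V) (a : ℕ) : V := if a < n then v a else w ((a : ℤ) - n)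

theorem IsPendantMap.injOn_sunVertex (h : IsPendantMap G n v w) (hv : IsShortestCycleMap G n v) :
    Set.InjOn (sunVertex n v w) (Set.Iio (2 * n)) := by
  have key : ∀ a b : ℕ, a < b → b < 2 * n → sunVertex n v w a ≠ sunVertex n v w b := by
    intro a b hab hb hE
    by_cases hbn : b < n
    · simp only [sunVertex, hbn, hab.trans hbn, if_true, hv.eq_iff] at hE
      have := Int.le_of_dvd (by omega) hE
      omega
    · by_cases han : a < n
      · simp only [sunVertex, hbn, han, if_true, if_false] at hE
        exact h.ne _ _ hE.symm
      · simp only [sunVertex, hbn, han, if_false, h.eq_iff] at hE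
        have := Int.le_of_dvd (by omega) hE
        omega
  intro a ha b hb hE
  by_contra hne
  rcases Nat.lt_or_gt_of_ne hne with hlt | hlt
  · exact key a b hlt hb hE
  · exact key b a hlt ha hE.symm

variable [Fintype V] {L : Sym2 V → Finset ℕ}

theorem IsShortestCycleMap.exists_isPendantMap (hv : IsShortestCycleMap G n v)
    (H : MinimalCounterexample G L) (hn : 5 ≤ n) : ∃ w, IsPendantMap G n v w := by
  have hprev : ∀ i, G.Adj (v i) (v (i - 1)) := fun i => by
    simpa using (hv.adj (i - 1)).symm
  have hpn : ∀ i, v (i - 1) ≠ v (i + 1) := by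
    intro i h
    rw [hv.eq_iff] at h
    have := Int.le_of_dvd (by omega) h
    omega
  choose w hw hw1 hw2 hw3 using fun i => H.exists_third (hprev i) (hv.adj i) (hpn i)
  have hne : ∀ i j, w i ≠ v j := by
    intro i j h
    rcases hv.dvd_of_adj (h ▸ hw i) with h' | h'
    · refine hw2 i (h.trans ?_)
      rw [hv.eq_iff, ← Int.dvd_neg]
      convert h' using 1
      ring
    · refine hw1 i (h.trans ?_)
      rw [hv.eq_iff, ← Int.dvd_neg]
      convert h' using 1
      ring
  have hshift : ∀ i j k, (n : ℤ) ∣ j - i → v (i + k) = v (j + k) := by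
    intro i j k h
    rw [hv.eq_iff]
    convert h using 1
    ring
  refine ⟨w, hw, hw3, hne, fun i j => ⟨fun h => ?_, fun h => ?_⟩, fun i j d hd hdn h => ?_⟩
  · obtain ⟨d, hd, hdvd, hvd⟩ := hv.exists_eq_add i j
    by_cases h0 : d = 0
    · subst h0
      simpa using hdvd
    · have h1 := hv.le_of_common hdvd (by omega) hd (hne i) (hw i) (h ▸ hw j)
      have h2 := hv.le_of_common (i := j) (j := i) (d := n - d) (by
        rw [← Int.dvd_neg, Nat.cast_sub hd.le,
          show -(i - j - ((n : ℤ) - d)) = j - i - d + n by ring]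
        exact dvd_add hdvd (dvd_refl _)) (by omega) (by omega) (hne i) (h ▸ hw j) (hw i)
      omega
  · have h0 := hshift i j 0 h
    simp only [add_zero] at h0
    rcases hw3 j (w i) (h0 ▸ hw i) with h' | h' | h'
    · exact absurd h' (hne i _)
    · exact absurd h' (hne i _)
    · exact h'
  · by_cases h0 : d = 0
    · subst h0
      have h0 := hshift i j 0 (by simpa using hd)
      simp only [add_zero] at h0
      exact (H.no_triangle (hw i) (h0 ▸ hw j) h).elim
    · exact hv.le_of_link hd hdn (by omega) (hne i) (hne j) (hw i) (hw j) h

namespace MinimalCounterexample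

theorem five_le (H : MinimalCounterexample G L) (hv : IsShortestCycleMap G n v) : 5 ≤ n := by
  have h3 := hv.three_le
  have h01 : G.Adj (v 0) (v 1) := hv.adj 0
  have h12 : G.Adj (v 1) (v 2) := hv.adj 1
  have h23 : G.Adj (v 2) (v 3) := hv.adj 2
  have h34 : G.Adj (v 3) (v 4) := hv.adj 3
  by_contra! hlt
  rcases (by omega : n = 3 ∨ n = 4) with rfl | rfl
  · have h30 : v 3 = v 0 := (hv.eq_iff _ _).mpr (by decide)
    exact H.no_triangle h01 (h30 ▸ h23.symm) h12
  · have h40 : v 4 = v 0 := (hv.eq_iff _ _).mpr (by decide)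
    exact H.no_square h01 h12 h23 (h40 ▸ h34.symm) (by rw [ne_eq, hv.eq_iff]; decide)
      (by rw [ne_eq, hv.eq_iff]; decide)

theorem ne_five (H : MinimalCounterexample G L) (hv : IsShortestCycleMap G n v) : n ≠ 5 := by
  rintro rfl
  obtain ⟨w, hw⟩ := hv.exists_isPendantMap H le_rfl
  have h01 : G.Adj (v 0) (v 1) := hv.adj 0
  have h12 : G.Adj (v 1) (v 2) := hv.adj 1
  have h23 : G.Adj (v 2) (v 3) := hv.adj 2
  have h34 : G.Adj (v 3) (v 4) := hv.adj 3
  have h45 : G.Adj (v 4) (v 5) := hv.adj 4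
  have h50 : v 5 = v 0 := (hv.eq_iff _ _).mpr (by decide)
  have h40 : G.Adj (v 0) (v 4) := h50 ▸ h45.symm
  refine H.not_colourable (reducibleFamily_pentagon.colourable H.subcubic H.lists H.avoiding
    (p := sunVertex 5 v w) (hw.injOn_sunVertex hv) ?_ ?_ (by simp))
  · simp [sunVertex, h01, h12, h23, h34, h40, hw.adj]
  · have : missingT 10 [(0, 5), (0, 1), (1, 6), (1, 2), (2, 7), (2, 3), (3, 8), (3, 4), (4, 9),
        (0, 4)] [(5, 7), (6, 8), (7, 9), (5, 8), (6, 9)] =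
        [(5, 6), (5, 9), (6, 7), (7, 8), (8, 9)] := by decide +kernel
    have key : ∀ i j : ℤ, (5 : ℤ) ∣ j - i - 1 → ¬ G.Adj (w i) (w j) := fun i j h h' => by
      simpa using hw.le_of_adj i j 1 h (by norm_num) h'
    simp only [this, List.forall_mem_cons, List.not_mem_nil, false_imp_iff, implies_true, and_true]
    simp only [sunVertex]
    norm_num
    refine ⟨?_, fun h => ?_, ?_, ?_, ?_⟩
    · exact key _ _ (by decide)
    · exact key _ _ (by decide) h.symm
    · exact key _ _ (by decide)
    · exact key _ _ (by decide)
    · exact key _ _ (by decide)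

theorem ne_six (H : MinimalCounterexample G L) (hv : IsShortestCycleMap G n v) : n ≠ 6 := by
  rintro rfl
  obtain ⟨w, hw⟩ := hv.exists_isPendantMap H (by norm_num)
  have h01 : G.Adj (v 0) (v 1) := hv.adj 0
  have h12 : G.Adj (v 1) (v 2) := hv.adj 1
  have h23 : G.Adj (v 2) (v 3) := hv.adj 2
  have h34 : G.Adj (v 3) (v 4) := hv.adj 3
  have h45 : G.Adj (v 4) (v 5) := hv.adj 4
  have h56 : G.Adj (v 5) (v 6) := hv.adj 5
  have h60 : v 6 = v 0 := (hv.eq_iff _ _).mpr (by decide)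
  have h50 : G.Adj (v 0) (v 5) := h60 ▸ h56.symm
  refine H.not_colourable (reducibleFamily_hexagon.colourable H.subcubic H.lists H.avoiding
    (p := sunVertex 6 v w) (hw.injOn_sunVertex hv) ?_ ?_ (by simp))
  · simp [sunVertex, h01, h12, h23, h34, h45, h50, hw.adj]
  · have : missingT 12 [(0, 6), (0, 1), (1, 7), (1, 2), (2, 8), (2, 3), (3, 9), (3, 4), (4, 10),
        (4, 5), (5, 11), (0, 5)] [(6, 9), (7, 10), (8, 11)] =
        [(6, 7), (6, 8), (6, 10), (6, 11), (7, 8), (7, 9), (7, 11), (8, 9), (8, 10), (9, 10),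
          (9, 11), (10, 11)] := by decide +kernel
    have key : ∀ i j : ℤ, (6 : ℤ) ∣ j - i - 1 ∨ (6 : ℤ) ∣ j - i - 2 → ¬ G.Adj (w i) (w j) := by
      rintro i j (h | h) h'
      · simpa using hw.le_of_adj i j 1 h (by norm_num) h'
      · simpa using hw.le_of_adj i j 2 h (by norm_num) h'
    simp only [this, List.forall_mem_cons, List.not_mem_nil, false_imp_iff, implies_true, and_true]
    simp only [sunVertex]
    norm_num
    refine ⟨?_, ?_, fun h => ?_, fun h => ?_, ?_, ?_, fun h => ?_, ?_, ?_, ?_, ?_, ?_⟩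
    · exact key _ _ (by decide)
    · exact key _ _ (by decide)
    · exact key _ _ (by decide) h.symm
    · exact key _ _ (by decide) h.symm
    · exact key _ _ (by decide)
    · exact key _ _ (by decide)
    · exact key _ _ (by decide) h.symm
    all_goals exact key _ _ (by decide)

end MinimalCounterexample

end Pendants

section LongCycle

open Classical

/-- The edges `… , s(v 0, v 1), s(v 1, w 1), s(v 1, v 2), s(v 2, w 2), …` at a cycle. -/
def sunEdge {V : Type*} (v w : ℤ → V) (t : ℤ) : Sym2 V :=
  s(v (t / 2), if t % 2 = 0 then v (t / 2 - 1) else w (t / 2))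

theorem mem_cycleEdges_of_near {k a b : ℕ} (hk : 4 ≤ k) (hab : a < b) (hb : b < 2 * k + 6)
    (h : b ≤ a + 3 ∨ (b = a + 4 ∧ a % 2 = 0) ∨ a + 2 * k + 6 ≤ b + 3 ∨
      (a + 2 * k + 6 = b + 4 ∧ a % 2 = 0)) :
    (a, b) ∈ cycleEdges k ∨ (b, a) ∈ cycleEdges k := by
  by_cases hmid : 3 ≤ b ∧ b < 2 * k + 3 ∧ b ≤ a + 4
  · left
    refine List.mem_append_right _ (mem_pathEdges.mpr ⟨(b - 3) / 2, by omega,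
      (a - 2 * ((b - 3) / 2), b - 2 * ((b - 3) / 2)), ?_, ?_⟩)
    · generalize hc : a - 2 * ((b - 3) / 2) = c
      generalize hd : b - 2 * ((b - 3) / 2) = d
      have : (d = 3 ∧ c ≤ 2) ∨ (d = 4 ∧ c ≤ 3) := by omega
      rcases this with ⟨rfl, h'⟩ | ⟨rfl, h'⟩ <;> interval_cases c <;> decide
    · ext <;> simp <;> omega
  · have hclose : ∀ q ∈ closingEdges, (pathWindow k q.1, pathWindow k q.2) ∈ cycleEdges k :=
      fun q hq => List.mem_append_left _ (List.mem_map.mpr ⟨q, hq, rfl⟩)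
    simp only [closingEdges, List.forall_mem_cons, pathWindow] at hclose
    norm_num at hclose
    simp only [show 2 * k + 6 - 3 = 2 * k + 3 by omega, show 2 * k + 7 - 3 = 2 * k + 4 by omega,
      show 2 * k + 8 - 3 = 2 * k + 5 by omega] at hclose
    have hcases : (b = 1 ∧ a = 0) ∨ (b = 2 ∧ a = 0) ∨ (b = 2 ∧ a = 1) ∨ (b = 2 * k + 2 ∧ a = 0) ∨
        (b = 2 * k + 3 ∧ (a = 0 ∨ a = 2 * k ∨ a = 2 * k + 1 ∨ a = 2 * k + 2)) ∨
        (b = 2 * k + 4 ∧ (a = 0 ∨ a = 1 ∨ a = 2 ∨ a = 2 * k ∨ a = 2 * k + 1 ∨ a = 2 * k + 2 ∨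
          a = 2 * k + 3)) ∨
        (b = 2 * k + 5 ∧ (a = 0 ∨ a = 1 ∨ a = 2 ∨ a = 2 * k + 2 ∨ a = 2 * k + 3 ∨
          a = 2 * k + 4)) := by
      omega
    rcases hcases with ⟨rfl, rfl⟩ | ⟨rfl, rfl⟩ | ⟨rfl, rfl⟩ | ⟨rfl, rfl⟩ |
      ⟨rfl, rfl | rfl | rfl | rfl⟩ | ⟨rfl, rfl | rfl | rfl | rfl | rfl | rfl | rfl⟩ |
      ⟨rfl, rfl | rfl | rfl | rfl | rfl | rfl⟩ <;> simp [hclose]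

theorem mem_sunEdge {V : Type*} {v w : ℤ → V} {t : ℤ} {x : V} (hx : x ∈ sunEdge v w t) :
    (∃ a, x = v a ∧ (a = t / 2 ∨ t % 2 = 0 ∧ a = t / 2 - 1)) ∨ x = w (t / 2) ∧ t % 2 = 1 := by
  rw [sunEdge] at hx
  by_cases h : t % 2 = 0
  · rw [if_pos h] at hx
    rcases Sym2.mem_iff.mp hx with rfl | rfl
    · exact Or.inl ⟨_, rfl, Or.inl rfl⟩
    · exact Or.inl ⟨_, rfl, Or.inr ⟨h, rfl⟩⟩
  · rw [if_neg h] at hx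
    rcases Sym2.mem_iff.mp hx with rfl | rfl
    · exact Or.inl ⟨_, rfl, Or.inl rfl⟩
    · exact Or.inr ⟨rfl, by omega⟩

theorem IsPendantMap.dvd_of_near {V : Type*} {G : SimpleGraph V} {n : ℕ} {v w : ℤ → V}
    (hw : IsPendantMap G n v w) (hv : IsShortestCycleMap G n v) (hn : 7 ≤ n) {s t : ℤ} {x y : V}
    (hx : x ∈ sunEdge v w s) (hy : y ∈ sunEdge v w t) (hxy : x = y ∨ G.Adj x y) :
    ∃ z, (n : ℤ) ∣ z ∧ (t - 3 ≤ s + 2 * z ∧ s + 2 * z ≤ t + 3 ∨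
      s % 2 = 0 ∧ t % 2 = 0 ∧ (s + 2 * z = t + 4 ∨ t = s + 2 * z + 4)) := by
  have hvw : ∀ {a b}, v a = w b ∨ G.Adj (v a) (w b) → (n : ℤ) ∣ b - a := by
    rintro a b (h | h)
    · exact (hw.ne _ _ h.symm).elim
    · rcases hw.eq_or _ _ h with h | h | h
      · exact (hw.ne _ _ h).elim
      · exact (hw.ne _ _ h).elim
      · exact (hw.eq_iff _ _).mp h.symm
  rcases mem_sunEdge hx with ⟨a, rfl, ha⟩ | ⟨rfl, hs⟩ <;>
    rcases mem_sunEdge hy with ⟨b, rfl, hb⟩ | ⟨rfl, ht⟩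
  · have : (n : ℤ) ∣ b - a ∨ (n : ℤ) ∣ b - a - 1 ∨ (n : ℤ) ∣ b - a + 1 :=
      hxy.imp (hv.eq_iff _ _).mp hv.dvd_of_adj
    rcases this with h | h | h <;> exact ⟨_, h, by omega⟩
  · exact ⟨_, hvw hxy, by omega⟩
  · exact ⟨_, (Int.dvd_neg).mpr (hvw (hxy.imp Eq.symm fun h => h.symm)), by omega⟩
  · rcases hxy with h | h
    · exact ⟨_, (hw.eq_iff _ _).mp h, by omega⟩
    · have := hw.le_six hv h
      omega

theorem sunEdge_add {V : Type*} {G : SimpleGraph V} {n : ℕ} {v w : ℤ → V}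
    (hw : IsPendantMap G n v w) (hv : IsShortestCycleMap G n v) (t z : ℤ) (hz : (n : ℤ) ∣ z) :
    sunEdge v w (t + 2 * z) = sunEdge v w t := by
  have h1 : (t + 2 * z) / 2 = t / 2 + z := by omega
  have h2 : (t + 2 * z) % 2 = t % 2 := by omega
  have hz' : (n : ℤ) ∣ -z := (Int.dvd_neg).mpr hz
  have h3 : v (t / 2 + z) = v (t / 2) := (hv.eq_iff _ _).mpr (by simpa using hz')
  have h4 : w (t / 2 + z) = w (t / 2) := (hw.eq_iff _ _).mpr (by simpa using hz')
  have h5 : v (t / 2 + z - 1) = v (t / 2 - 1) := (hv.eq_iff _ _).mpr (by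
    convert hz' using 1
    ring)
  rw [sunEdge, sunEdge, h1, h2, h3, h4, h5]

end LongCycle

section LongCycleColouring

open Classical

variable {V : Type*} {G : SimpleGraph V} {n : ℕ} {v w : ℤ → V}

theorem sunEdge_two_mul (v w : ℤ → V) (i : ℤ) : sunEdge v w (2 * i) = s(v i, v (i - 1)) := by
  simp [sunEdge]

theorem sunEdge_two_mul_add_one (v w : ℤ → V) (i : ℤ) :
    sunEdge v w (2 * i + 1) = s(v i, w i) := by
  have h1 : (2 * i + 1) / 2 = i := by omega
  have h2 : ¬ (2 * i + 1) % 2 = 0 := by omega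
  rw [sunEdge, h1, if_neg h2]

theorem exists_sunEdge_eq (hw : IsPendantMap G n v w) {i : ℤ} {y : V} (h : G.Adj (v i) y) :
    ∃ t, s(v i, y) = sunEdge v w t := by
  rcases hw.eq_or _ _ h with rfl | rfl | rfl
  · exact ⟨2 * i, (sunEdge_two_mul v w i).symm⟩
  · refine ⟨2 * (i + 1), ?_⟩
    rw [sunEdge_two_mul, Sym2.eq_swap, add_sub_cancel_right]
  · exact ⟨2 * i + 1, (sunEdge_two_mul_add_one v w i).symm⟩

theorem sunEdge_mem_edgeSet (hv : IsShortestCycleMap G n v) (hw : IsPendantMap G n v w) (t : ℤ) :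
    sunEdge v w t ∈ G.edgeSet := by
  rcases Int.even_or_odd' t with ⟨i, rfl | rfl⟩
  · rw [sunEdge_two_mul, SimpleGraph.mem_edgeSet]
    simpa using (hv.adj (i - 1)).symm
  · rw [sunEdge_two_mul_add_one, SimpleGraph.mem_edgeSet]
    exact hw.adj i

theorem sunEdge_inj (hv : IsShortestCycleMap G n v) (hw : IsPendantMap G n v w) {s t : ℤ}
    (h : sunEdge v w s = sunEdge v w t) : ∃ z, (n : ℤ) ∣ z ∧ t = s + 2 * z := by
  have hn := hv.three_le
  rcases Int.even_or_odd' s with ⟨i, rfl | rfl⟩ <;> rcases Int.even_or_odd' t with ⟨j, rfl | rfl⟩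
  · simp only [sunEdge_two_mul, Sym2.eq_iff, hv.eq_iff] at h
    rcases h with ⟨h, -⟩ | ⟨h1, h2⟩
    · exact ⟨_, h, by ring⟩
    · have h3 := dvd_sub h2 h1
      have := Int.le_of_dvd (by omega) h3
      omega
  · rw [sunEdge_two_mul, sunEdge_two_mul_add_one, Sym2.eq_iff] at h
    rcases h with ⟨-, h⟩ | ⟨h, -⟩ <;> exact (hw.ne _ _ h.symm).elim
  · rw [sunEdge_two_mul, sunEdge_two_mul_add_one, Sym2.eq_iff] at h
    rcases h with ⟨-, h⟩ | ⟨-, h⟩ <;> exact (hw.ne _ _ h).elim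
  · rw [sunEdge_two_mul_add_one, sunEdge_two_mul_add_one, Sym2.eq_iff, hv.eq_iff] at h
    rcases h with ⟨h, -⟩ | ⟨-, h⟩
    · exact ⟨_, h, by ring⟩
    · exact (hw.ne _ _ h).elim

theorem cycleEdges_lt {k : ℕ} (hk : 4 ≤ k) : ∀ p ∈ cycleEdges k, p.1 < 2 * (k + 3) ∧
    p.2 < 2 * (k + 3) := by
  intro p hp
  rcases List.mem_append.mp hp with hp | hp
  · obtain ⟨q, hq, rfl⟩ := List.mem_map.mp hp
    have hq9 := (by decide : ∀ q ∈ closingEdges, q.1 < 9 ∧ q.2 < 9) q hq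
    simp only [pathWindow]
    constructor <;> split_ifs <;> omega
  · obtain ⟨j, hj, q, hq, rfl⟩ := mem_pathEdges.mp hp
    have hq4 := (by decide : ∀ q ∈ pathBlock, q.1 ≤ 4 ∧ q.2 ≤ 4) q hq
    simp only
    omega

variable [Fintype V] {L : Sym2 V → Finset ℕ} {A : Finset (Sym2 V)}

theorem degIn_cycle_eq_zero (hw : IsPendantMap G n v w) (hA : A ⊆ edges G)
    (hvA : ∀ t, sunEdge v w t ∉ A) (i : ℤ) : degIn A (v i) = 0 := by
  have := degIn_add_card_le hA (v := v i) (S := nbr G (v i)) subset_rfl (by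
    intro y hy
    obtain ⟨t, ht⟩ := exists_sunEdge_eq hw (mem_nbr.mp hy)
    rw [ht]
    exact hvA t)
  omega

theorem card_nearIn_cycle_le (hG : ∀ v, (nbr G v).card ≤ 3) (hw : IsPendantMap G n v w)
    (hA : A ⊆ edges G) (hvA : ∀ t, sunEdge v w t ∉ A) (i : ℤ) :
    (nearIn G A (sunEdge v w (2 * i))).card ≤ 4 := by
  have hdeg : ∀ i, degIn A (w i) ≤ 2 := by
    intro i
    have := degIn_add_card_le hA (v := w i) (S := {v i}) (by simpa using (hw.adj i).symm) (by
      intro y hy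
      rw [Finset.mem_singleton.mp hy, Sym2.eq_swap, ← sunEdge_two_mul_add_one]
      exact hvA _)
    have := hG (w i)
    rw [Finset.card_singleton] at *
    omega
  have h0 := hvA (2 * i)
  rw [sunEdge_two_mul] at h0 ⊢
  refine (card_nearIn_le hA h0).trans ?_
  refine (Finset.sum_le_sum_of_ne_zero (t := {w i, w (i - 1)}) ?_).trans ?_
  · intro y hy hy0
    have hyv : ∀ j, y ≠ v j := by
      rintro j rfl
      exact hy0 (degIn_cycle_eq_zero hw hA hvA j)
    simp only [Finset.mem_sdiff, Finset.mem_union, mem_nbr] at hy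
    simp only [Finset.mem_insert, Finset.mem_singleton]
    rcases hy.1 with h | h <;> rcases hw.eq_or _ _ h with h | h | h
    · exact (hyv _ h).elim
    · exact (hyv _ h).elim
    · exact Or.inl h
    · exact (hyv _ h).elim
    · exact (hyv _ h).elim
    · exact Or.inr h
  · refine (Finset.sum_le_card_nsmul _ _ 2 ?_).trans ?_
    · simp [hdeg]
    · have := Finset.card_le_two (a := w i) (b := w (i - 1))
      simp only [smul_eq_mul]
      omega

theorem card_nearIn_pendant_le (hG : ∀ v, (nbr G v).card ≤ 3) (hw : IsPendantMap G n v w)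
    (hA : A ⊆ edges G) (hvA : ∀ t, sunEdge v w t ∉ A) (i : ℤ) :
    (nearIn G A (sunEdge v w (2 * i + 1))).card ≤ 6 := by
  have h0 := hvA (2 * i + 1)
  rw [sunEdge_two_mul_add_one] at h0 ⊢
  refine (card_nearIn_le hA h0).trans ?_
  refine (Finset.sum_le_sum_of_ne_zero (t := nbr G (w i) \ {v i}) ?_).trans ?_
  · intro y hy hy0
    have hyv : ∀ j, y ≠ v j := by
      rintro j rfl
      exact hy0 (degIn_cycle_eq_zero hw hA hvA j)
    simp only [Finset.mem_sdiff, Finset.mem_union, mem_nbr, Finset.mem_insert,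
      Finset.mem_singleton] at hy ⊢
    refine ⟨hy.1.resolve_left fun h => ?_, hyv i⟩
    rcases hw.eq_or _ _ h with h | h | h
    · exact hyv _ h
    · exact hyv _ h
    · exact hy.2 (Or.inr h)
  · refine (Finset.sum_le_card_nsmul _ _ 3 fun y _ => (degIn_le hA y).trans (hG y)).trans ?_
    have h1 := card_nbr_sdiff (hw.adj i).symm
    have h2 := hG (w i)
    simp only [smul_eq_mul]
    omega

theorem MinimalCounterexample.not_isShortestCycleMap (H : MinimalCounterexample G L)
    (hv : IsShortestCycleMap G n v) : False := by
  have hn5 := H.five_le hv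
  have hne5 := H.ne_five hv
  have hne6 := H.ne_six hv
  have hn : 7 ≤ n := by omega
  obtain ⟨w, hw⟩ := hv.exists_isPendantMap H hn5
  let x : ℕ → Sym2 V := fun k => sunEdge v w k
  obtain ⟨A, hA⟩ : ∃ A, A = edges G \ (Finset.range (2 * n)).image x := ⟨_, rfl⟩
  have hAG : A ⊆ edges G := hA ▸ Finset.sdiff_subset
  have hvA : ∀ t, sunEdge v w t ∉ A := by
    intro t ht
    rw [hA, Finset.mem_sdiff] at ht
    refine ht.2 (Finset.mem_image.mpr ⟨(t % (2 * n)).toNat, ?_, ?_⟩)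
    · have := Int.emod_lt_of_pos t (b := 2 * n) (by omega)
      rw [Finset.mem_range]
      omega
    · have h0 := Int.emod_nonneg t (b := 2 * n) (by omega)
      simp only [x, Int.toNat_of_nonneg h0]
      rw [← sunEdge_add hw hv (t % (2 * n)) (n * (t / (2 * n))) (dvd_mul_right _ _),
        ← mul_assoc, Int.emod_add_mul_ediv]
  have hR : ∀ i, v i ∈ Finset.univ.filter fun u => ∃ j, v j = u := fun i => by simp
  have hgood : Colourable G L A := by
    refine Colourable.of_edgesAvoiding H.subcubic H.lists ?_
      (H.avoiding (Finset.univ.filter fun u => ∃ j, v j = u)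
        ⟨v 0, hR 0, Finset.card_pos.mpr ⟨_, mem_nbr.mpr (hv.adj 0)⟩⟩) hAG ?_
    · intro u hu
      obtain ⟨i, rfl⟩ := (Finset.mem_filter.mp hu).2
      have hsub : {v (i - 1), v (i + 1)} ⊆
          nbr G (v i) ∩ Finset.univ.filter fun u => ∃ j, v j = u := by
        intro y hy
        simp only [Finset.mem_insert, Finset.mem_singleton] at hy
        rw [Finset.mem_inter, mem_nbr]
        rcases hy with rfl | rfl
        · exact ⟨by simpa using (hv.adj (i - 1)).symm, hR _⟩
        · exact ⟨hv.adj i, hR _⟩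
      refine le_trans (Finset.card_pair fun h => ?_).ge (Finset.card_le_card hsub)
      have := Int.le_of_dvd (by omega) ((hv.eq_iff _ _).mp h)
      omega
    · intro u hu u' _ huA
      obtain ⟨i, rfl⟩ := (Finset.mem_filter.mp hu).2
      obtain ⟨t, ht⟩ := exists_sunEdge_eq hw
        (SimpleGraph.mem_edgeSet G |>.mp (mem_edges.mp (hAG huA)))
      exact hvA t (ht ▸ huA)
  have hbound : ∀ z : ℤ, (n : ℤ) ∣ z → -n < z → z < n → z = 0 := fun z hz h1 h2 =>
    Int.eq_zero_of_abs_lt_dvd hz (abs_lt.mpr ⟨h1, h2⟩)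
  have hk : 2 * (n - 3) + 6 = 2 * n := by omega
  refine H.not_colourable ((hgood.union_image (N := 2 * n) x (cycleEdges (n - 3))
    (cycleExp (n - 3)) ?_ ?_ (orientCoeff_cycleEdges_ne_zero (by omega)) ?_ (fun i _ => hvA i)
    ?_ ?_).mono ?_)
  · have := cycleEdges_lt (k := n - 3) (by omega)
    rwa [show n - 3 + 3 = n by omega] at this
  · exact fun i hi => (cycleExp_le (by omega) i).2 (by omega)
  · intro i hi j hj hij
    obtain ⟨z, hz, h⟩ := sunEdge_inj hv hw hij
    have := hbound z hz (by omega) (by omega)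
    omega
  · rintro i j hij hj ⟨-, a, ha, b, hb, hab⟩
    obtain ⟨z, hz, h⟩ := hw.dvd_of_near hv hn ha hb hab
    have h1 : z = 0 ∨ z = n := by
      by_cases hzn : z < n
      · exact Or.inl (hbound z hz (by omega) hzn)
      · have := hbound (z - n) (dvd_sub_self_right.mpr hz) (by omega) (by omega)
        omega
    refine mem_cycleEdges_of_near (by omega) hij (by omega) ?_
    rcases h1 with rfl | rfl <;> omega
  · intro i hi
    have hL := H.lists _ (sunEdge_mem_edgeSet hv hw i)
    have hm := (cycleExp_le (k := n - 3) (by omega) i).1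
    rcases Nat.even_or_odd' i with ⟨c, rfl | rfl⟩
    · have := card_nearIn_cycle_le H.subcubic hw hAG hvA c
      rw [if_pos (by omega)] at hm
      simp only [x]
      push_cast at *
      omega
    · have := card_nearIn_pendant_le H.subcubic hw hAG hvA c
      rw [if_neg (by omega)] at hm
      simp only [x]
      push_cast at *
      omega
  · rw [hA]
    intro e he
    by_cases hx : e ∈ (Finset.range (2 * n)).image x
    · exact Finset.mem_union_right _ hx
    · exact Finset.mem_union_left _ (Finset.mem_sdiff.mpr ⟨he, hx⟩)

end LongCycleColouring

section Main

open Classical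

variable {V : Type*} {G : SimpleGraph V} {L : Sym2 V → Finset ℕ}

theorem edgesNear_of_edgeConflict {e f : Sym2 V} (h : edgeConflict G e f) : EdgesNear G e f := by
  obtain ⟨hne, ⟨v, hve, hvf⟩ | ⟨g, hg, ⟨x, hxe, hxg⟩, y, hyg, hyf⟩⟩ := h
  · exact ⟨hne, v, hve, v, hvf, Or.inl rfl⟩
  · refine ⟨hne, x, hxe, y, hyf, or_iff_not_imp_left.mpr fun hxy => ?_⟩
    rwa [(Sym2.mem_and_mem_iff hxy).mp ⟨hxg, hyg⟩, SimpleGraph.mem_edgeSet] at hg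

variable [Fintype V]

theorem MinimalCounterexample.elim (H : MinimalCounterexample G L) : False := by
  obtain ⟨a, b, hab⟩ : ∃ a b, G.Adj a b := by
    by_contra! h
    refine H.not_colourable ⟨fun _ => 0, fun e he => ?_, fun e he => ?_⟩ <;>
    · induction e with
      | h a b => exact (h a b (by simpa using he)).elim
  have hex : ∀ a b, ∃ c, G.Adj a b → G.Adj b c ∧ c ≠ a := by
    intro a b
    by_cases h : G.Adj a b
    · have hcard := H.card_nbr h.symm
      obtain ⟨c, hc, hca⟩ := Finset.exists_mem_ne (by omega : 1 < (nbr G b).card) a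
      exact ⟨c, fun _ => ⟨mem_nbr.mp hc, hca⟩⟩
    · exact ⟨a, fun h' => (h h').elim⟩
  choose f hf using hex
  obtain ⟨n, v, hv⟩ := exists_isShortestCycleMap (exists_isCycleMap f hf hab)
  exact H.not_isShortestCycleMap hv

/-- The graph obtained by removing the edges at a set of vertices. -/
def removeAt (G : SimpleGraph V) (R : Finset V) : SimpleGraph V where
  Adj a b := G.Adj a b ∧ a ∉ R ∧ b ∉ R
  symm := ⟨fun _ _ h => ⟨h.1.symm, h.2.2, h.2.1⟩⟩
  loopless := ⟨fun _ h => h.1.ne rfl⟩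

theorem edges_removeAt (R : Finset V) : edges (removeAt G R) = edgesAvoiding G R := by
  ext e
  induction e with
  | h a b => simp [edgesAvoiding, removeAt]

theorem Colourable.of_removeAt {R : Finset V}
    (h : Colourable (removeAt G R) L (edges (removeAt G R))) :
    Colourable G L (edgesAvoiding G R) := by
  rw [edges_removeAt] at h
  obtain ⟨φ, h1, h2⟩ := h
  refine ⟨φ, h1, fun e he f hf => ?_⟩
  rintro ⟨hne, x, hx, y, hy, hxy⟩
  exact h2 e he f hf ⟨hne, x, hx, y, hy, hxy.imp id fun h =>
    ⟨h, (Finset.mem_filter.mp he).2 x hx, (Finset.mem_filter.mp hf).2 y hy⟩⟩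

theorem colourable_edges (G : SimpleGraph V) (hG : ∀ v, (nbr G v).card ≤ 3)
    (hL : ∀ e ∈ G.edgeSet, 10 ≤ (L e).card) : Colourable G L (edges G) := by
  induction hn : (edges G).card using Nat.strong_induction_on generalizing G with
  | _ n ih =>
  by_contra hcol
  refine MinimalCounterexample.elim (G := G) (L := L) ⟨hG, hL, fun R hR => ?_, hcol⟩
  refine Colourable.of_removeAt (ih _ ?_ (removeAt G R) (fun v => ?_) (fun e he => ?_) rfl)
  · rw [edges_removeAt, ← hn]
    refine Finset.card_lt_card (Finset.filter_ssubset.mpr ?_)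
    obtain ⟨v, hvR, hv⟩ := hR
    obtain ⟨y, hy⟩ := Finset.card_pos.mp hv
    exact ⟨s(v, y), by simpa using hy, fun h => h v (Sym2.mem_mk_left _ _) hvR⟩
  · refine (Finset.card_le_card fun y hy => ?_).trans (hG v)
    rw [mem_nbr] at hy ⊢
    exact hy.1
  · have := mem_edges.mpr he
    rw [edges_removeAt] at this
    exact hL e (mem_edges.mp (Finset.mem_filter.mp this).1)

end Main

/-- Every subcubic graph is strongly 10-edge choosable: for every list assignment giving
each edge at least 10 colors there is a strong edge coloring from the lists. -/
theorem subcubic_strongly_10_choosable {V : Type*} [Fintype V] [DecidableEq V]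
    (G : SimpleGraph V) [DecidableRel G.Adj] (hG : ∀ v, G.degree v ≤ 3) :
    StronglyEdgeChoosable G 10 := by
  intro L hL
  have hG' : ∀ v, (nbr G v).card ≤ 3 := fun v => by
    refine le_trans (le_of_eq ?_) (hG v)
    rw [← SimpleGraph.card_neighborFinset_eq_degree]
    congr 1
    ext y
    simp
  obtain ⟨φ, h1, h2⟩ := colourable_edges G hG' hL
  exact ⟨φ, fun e he f hf h => h2 e (mem_edges.mpr he) f (mem_edges.mpr hf)
    (edgesNear_of_edgeConflict h), fun e he => h1 e (mem_edges.mpr he)⟩
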